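/- Suppose (X_i)_{i∈ℤ} is a strictly stationary sequence of ℝ^d-valued random vectors (d ≥ 2) whose alpha-mixing coefficients satisfy α(k) = O(a^k) as k → ∞ for some a ∈ (0,1), whose marginal c.d.f.s are continuous, and whose copula C satisfies Condition 2.1. Then for every c ∈ (0,1) and every ω ∈ (0,1/2), sup_{u ∈ [c/n, 1−c/n]^d} | ĈP_n(u)/g_ω(u) − C̄_n(u)/g_ω(u) | converges to 0 in (outer) probability as n → ∞. -/

import Mathlib

open MeasureTheory Filter Set
open scoped ENNReal NNReal

noncomputable section

namespace BBV

variable {Ω : Type*} [MeasurableSpace Ω] {E : Type*} [MeasurableSpace E] {d : ℕ}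

/-- The real-valued indicator function of a set. -/
def indic {α : Type*} (s : Set α) (x : α) : ℝ := s.indicator (fun _ => (1 : ℝ)) x

/-- `Z n = o_P(r n)`: convergence to zero in (outer) probability at rate `r`. -/
def oP (P : Measure Ω) (Z : ℕ → Ω → ℝ) (r : ℕ → ℝ) : Prop :=
  ∀ ε : ℝ, 0 < ε → Tendsto (fun n => P {ω | ε * r n < |Z n ω|}) atTop (nhds 0)

/-- `Z n = o_P(1)`: convergence to zero in (outer) probability. -/
def oP1 (P : Measure Ω) (Z : ℕ → Ω → ℝ) : Prop := oP P Z fun _ => 1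

/-- `Z n = O_P(1)`: boundedness in (outer) probability. -/
def bigOP (P : Measure Ω) (Z : ℕ → Ω → ℝ) : Prop :=
  ∀ ε : ℝ, 0 < ε → ∃ M : ℝ, ∀ᶠ n in atTop, P {ω | M < |Z n ω|} ≤ ENNReal.ofReal ε

/-- Strict stationarity of a two-sided sequence: all finite-dimensional distributions
are invariant under shifts. -/
def StrictlyStationary (P : Measure Ω) (X : ℤ → Ω → E) : Prop :=
  ∀ (m : ℕ) (idx : Fin m → ℤ) (k : ℤ),
    Measure.map (fun ω (p : Fin m) => X (idx p + k) ω) P =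
      Measure.map (fun ω (p : Fin m) => X (idx p) ω) P

/-- The sigma-field generated by the variables `X i`, `i ∈ S`. -/
def mixSigma (X : ℤ → Ω → E) (S : Set ℤ) : MeasurableSpace Ω :=
  ⨆ i ∈ S, MeasurableSpace.comap (X i) inferInstance

/-- The alpha-mixing coefficient of the sequence `X`. -/
def alphaMix (P : Measure Ω) (X : ℤ → Ω → E) (k : ℕ) : ℝ :=
  sSup {r : ℝ | ∃ (i : ℤ) (A B : Set Ω),
    MeasurableSet[mixSigma X (Set.Iic i)] A ∧
    MeasurableSet[mixSigma X (Set.Ici (i + (k : ℤ)))] B ∧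
    r = |(P (A ∩ B)).toReal - (P A).toReal * (P B).toReal|}

/-- Exponentially decaying alpha-mixing coefficients: `α(k) = O(a^k)` for some `a ∈ (0,1)`. -/
def ExpAlphaMixing (P : Measure Ω) (X : ℤ → Ω → E) : Prop :=
  ∃ a ∈ Set.Ioo (0 : ℝ) 1, ∃ c : ℝ, ∀ k : ℕ, 1 ≤ k → alphaMix P X k ≤ c * a ^ k

/-- Marginal c.d.f. `F_j` of the stationary sequence. -/
def margF (P : Measure Ω) (X : ℤ → Ω → Fin d → ℝ) (j : Fin d) (x : ℝ) : ℝ :=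
  (P {ω | X 0 ω j ≤ x}).toReal

/-- `U_i = (F_1(X_{i1}),…,F_d(X_{id}))`. -/
def Uv (P : Measure Ω) (X : ℤ → Ω → Fin d → ℝ) (i : ℤ) (ω : Ω) (j : Fin d) : ℝ :=
  margF P X j (X i ω j)

/-- The copula `C` of the stationary distribution, i.e. the c.d.f. of `U_0`. -/
def cop (P : Measure Ω) (X : ℤ → Ω → Fin d → ℝ) (u : Fin d → ℝ) : ℝ :=
  (P {ω | ∀ j, Uv P X 0 ω j ≤ u j}).toReal

/-- Empirical c.d.f. `G_n` of the (unobservable) sample `U_1,…,U_n`. -/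
def Gn (P : Measure Ω) (X : ℤ → Ω → Fin d → ℝ) (n : ℕ) (u : Fin d → ℝ) (ω : Ω) : ℝ :=
  (n : ℝ)⁻¹ * ∑ i ∈ Finset.Icc (1 : ℤ) (n : ℤ), indic {ω' | ∀ j, Uv P X i ω' j ≤ u j} ω

/-- The empirical process `α_n = √n (G_n − C)`. -/
def alphan (P : Measure Ω) (X : ℤ → Ω → Fin d → ℝ) (n : ℕ) (u : Fin d → ℝ) (ω : Ω) : ℝ :=
  Real.sqrt n * (Gn P X n u ω - cop P X u)

/-- Marginal empirical c.d.f. `G_{nj}` based on `U_{1j},…,U_{nj}`. -/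
def Gnj (P : Measure Ω) (X : ℤ → Ω → Fin d → ℝ) (n : ℕ) (j : Fin d) (s : ℝ) (ω : Ω) : ℝ :=
  (n : ℝ)⁻¹ * ∑ i ∈ Finset.Icc (1 : ℤ) (n : ℤ), indic {ω' | Uv P X i ω' j ≤ s} ω

/-- The marginal empirical process `α_{nj}(s) = √n (G_{nj}(s) − s)`. -/
def alphanj (P : Measure Ω) (X : ℤ → Ω → Fin d → ℝ) (n : ℕ) (j : Fin d) (s : ℝ) (ω : Ω) : ℝ :=
  Real.sqrt n * (Gnj P X n j s ω - s)

/-- Left-continuous generalized inverse: `H⁻(s) = inf{x : H(x) ≥ s}` for `s ≠ 0`,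
and `H⁻(0) = sup{x : H(x) = 0}`. -/
def genInv (H : ℝ → ℝ) (s : ℝ) : ℝ :=
  if s = 0 then sSup {x | H x = 0} else sInf {x | s ≤ H x}

/-- The marginal quantile process `β_{nj}(s) = √n (G_{nj}⁻(s) − s)`. -/
def betanj (P : Measure Ω) (X : ℤ → Ω → Fin d → ℝ) (n : ℕ) (j : Fin d) (s : ℝ) (ω : Ω) : ℝ :=
  Real.sqrt n * (genInv (fun x => Gnj P X n j x ω) s - s)

/-- Marginal empirical c.d.f. `F_{nj}` of the observations `X_{1j},…,X_{nj}`. -/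
def empCdfX (X : ℤ → Ω → Fin d → ℝ) (n : ℕ) (j : Fin d) (x : ℝ) (ω : Ω) : ℝ :=
  (n : ℝ)⁻¹ * ∑ i ∈ Finset.Icc (1 : ℤ) (n : ℤ), indic {ω' | X i ω' j ≤ x} ω

/-- Pseudo-observations `Û_{ij} = n/(n+1) · F_{nj}(X_{ij})`. -/
def pseudoObs (X : ℤ → Ω → Fin d → ℝ) (n : ℕ) (i : ℤ) (ω : Ω) (j : Fin d) : ℝ :=
  (n : ℝ) / ((n : ℝ) + 1) * empCdfX X n j (X i ω j) ω

/-- The empirical copula `Ĉ_n`. -/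
def empCop (X : ℤ → Ω → Fin d → ℝ) (n : ℕ) (u : Fin d → ℝ) (ω : Ω) : ℝ :=
  (n : ℝ)⁻¹ * ∑ i ∈ Finset.Icc (1 : ℤ) (n : ℤ), indic {ω' | ∀ j, pseudoObs X n i ω' j ≤ u j} ω

/-- The empirical copula process `ĈP_n = √n (Ĉ_n − C)`. -/
def hatCP (P : Measure Ω) (X : ℤ → Ω → Fin d → ℝ) (n : ℕ) (u : Fin d → ℝ) (ω : Ω) : ℝ :=
  Real.sqrt n * (empCop X n u ω - cop P X u)

/-- First-order partial derivative `Ċ_j` of `C`, defined everywhere as the limsup of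
difference quotients (which coincides with the partial derivative wherever it exists). -/
def Cdot (C : (Fin d → ℝ) → ℝ) (j : Fin d) (u : Fin d → ℝ) : ℝ :=
  Filter.limsup (fun h : ℝ => (C (Function.update u j (u j + h)) - C u) / h)
    (nhdsWithin 0 {(0 : ℝ)}ᶜ)

/-- The process `C̄_n(u) = α_n(u) − Σ_j Ċ_j(u) α_n(u^{(j)})`. -/
def Cbar (P : Measure Ω) (X : ℤ → Ω → Fin d → ℝ) (n : ℕ) (u : Fin d → ℝ) (ω : Ω) : ℝ :=
  alphan P X n u ω -
    ∑ j, Cdot (cop P X) j u * alphan P X n (Function.update (fun _ => (1 : ℝ)) j (u j)) ω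

/-- `C_n(u) = G_n(G_{n1}⁻(u₁),…,G_{nd}⁻(u_d))`. -/
def copGI (P : Measure Ω) (X : ℤ → Ω → Fin d → ℝ) (n : ℕ) (u : Fin d → ℝ) (ω : Ω) : ℝ :=
  Gn P X n (fun j => genInv (fun x => Gnj P X n j x ω) (u j)) ω

/-- The empirical copula process `𝔺_n = √n (C_n − C)` based on generalized inverses. -/
def CPgi (P : Measure Ω) (X : ℤ → Ω → Fin d → ℝ) (n : ℕ) (u : Fin d → ℝ) (ω : Ω) : ℝ :=
  Real.sqrt n * (copGI P X n u ω - cop P X u)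

/-- `g₁(u) = min{ min_j u_j , min_j [1 − min_{k ≠ j} u_k] }`. -/
def g1 (u : Fin d → ℝ) : ℝ :=
  min (⨅ j, u j) (⨅ j : Fin d, (1 - ⨅ k : {k : Fin d // k ≠ j}, u (k : Fin d)))

/-- The weight function `g_ω(u) = g₁(u)^ω`. -/
def gW (w : ℝ) (u : Fin d → ℝ) : ℝ := g1 u ^ w

/-- `g̃_ω(u) = g_ω(u) + 1{g_ω(u) = 0}`. -/
def gTilde (w : ℝ) (u : Fin d → ℝ) : ℝ := if gW w u = 0 then 1 else gW w u

/-- `N(a,b) = {u ∈ [0,1]^d : a < g₁(u) ≤ b}`. -/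
def NN (d : ℕ) (a b : ℝ) : Set (Fin d → ℝ) :=
  {u | (∀ j, 0 ≤ u j ∧ u j ≤ 1) ∧ a < g1 u ∧ g1 u ≤ b}

/-- `V_j = {u ∈ [0,1]^d : u_j ∈ (0,1)}`. -/
def VV (d : ℕ) (j : Fin d) : Set (Fin d → ℝ) :=
  {u | (∀ k, 0 ≤ u k ∧ u k ≤ 1) ∧ 0 < u j ∧ u j < 1}

/-- Condition 2.1: existence, continuity and growth bounds for the first and second
order partial derivatives of the copula `C`. -/
def Condition21 (C : (Fin d → ℝ) → ℝ) : Prop :=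
  (∀ j : Fin d, ∀ u ∈ VV d j,
    HasDerivAt (fun t => C (Function.update u j t)) (Cdot C j u) (u j)) ∧
  (∀ j : Fin d, ContinuousOn (Cdot C j) (VV d j)) ∧
  ∃ Cdd : Fin d → Fin d → (Fin d → ℝ) → ℝ,
    (∀ j₁ j₂ : Fin d, ∀ u ∈ VV d j₁ ∩ VV d j₂,
      HasDerivAt (fun t => Cdot C j₂ (Function.update u j₁ t)) (Cdd j₁ j₂ u) (u j₁)) ∧
    (∀ j₁ j₂ : Fin d, ContinuousOn (Cdd j₁ j₂) (VV d j₁ ∩ VV d j₂)) ∧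
    ∃ K : ℝ, 0 < K ∧ ∀ j₁ j₂ : Fin d, ∀ u ∈ VV d j₁ ∩ VV d j₂,
      |Cdd j₁ j₂ u| ≤ K * min (1 / (u j₁ * (1 - u j₁))) (1 / (u j₂ * (1 - u j₂)))

/-- The weighted modulus of continuity `M_n(δ,μ)` of the empirical process. -/
def Mn (P : Measure Ω) (X : ℤ → Ω → Fin d → ℝ) (n : ℕ) (δ μ : ℝ) (ω : Ω) : ℝ :=
  ⨆ q ∈ {q : (Fin d → ℝ) × (Fin d → ℝ) |
      q.1 ∈ Set.Icc 0 1 ∧ q.2 ∈ Set.Icc 0 1 ∧ dist q.1 q.2 ≤ δ},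
    |alphan P X n q.1 ω - alphan P X n q.2 ω| / max (dist q.1 q.2 ^ μ) ((n : ℝ) ^ (-μ))

/-- Condition 4.1 with parameter `θ₁`. -/
def Condition41 (P : Measure Ω) (X : ℤ → Ω → Fin d → ℝ) (θ₁ : ℝ) : Prop :=
  ∀ μ ∈ Set.Ioo (0 : ℝ) θ₁, ∀ δ : ℕ → ℝ, Tendsto δ atTop (nhds 0) →
    oP1 P (fun n ω => Mn P X n (δ n) μ ω)

/-- Condition 4.3 with parameters `θ₂, θ₃`. -/
def Condition43 (P : Measure Ω) (X : ℤ → Ω → Fin d → ℝ) (θ₂ θ₃ : ℝ) : Prop :=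
  ∀ w ∈ Set.Ioo (0 : ℝ) θ₂, ∀ lam ∈ Set.Ioo (0 : ℝ) θ₃, ∀ j : Fin d,
    bigOP P (fun n ω => ⨆ s ∈ Set.Ioo (0 : ℝ) 1,
      |alphanj P X n j s ω| / (s * (1 - s)) ^ w) ∧
    bigOP P (fun n ω => ⨆ s ∈ Set.Ioo ((n : ℝ) ^ (-lam)) (1 - (n : ℝ) ^ (-lam)),
      |betanj P X n j s ω| / (s * (1 - s)) ^ w)

lemma indic_mem {α : Type*} (s : Set α) (x : α) : indic s x = 1 ∧ x ∈ s ∨ indic s x = 0 ∧ x ∉ s := by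
  by_cases h : x ∈ s <;> simp [indic, h]

lemma measurable_indic {α : Type*} [MeasurableSpace α] {s : Set α} (hs : MeasurableSet s) :
    Measurable (indic s) := measurable_const.indicator hs

lemma integral_indic {α : Type*} [MeasurableSpace α] (μ : Measure α) {s : Set α}
    (hs : MeasurableSet s) : ∫ x, indic s x ∂μ = μ.real s := by
  unfold indic
  exact integral_indicator_one hs

/-- Covariance inequality between a bounded function and an event. -/
lemma abs_integral_mul_indic_sub_le {α : Type*} {m m0 : MeasurableSpace α} (hm : m ≤ m0)
    (μ : Measure α) [IsProbabilityMeasure μ] {B : Set α} (hB : MeasurableSet B) {f : α → ℝ}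
    (hf : Measurable[m] f) {M a : ℝ} (hM : ∀ x, |f x| ≤ M)
    (ha : ∀ A, MeasurableSet[m] A → |μ.real (A ∩ B) - μ.real A * μ.real B| ≤ a) :
    |∫ x, f x * (indic B x - μ.real B) ∂μ| ≤ 2 * M * a := by
  set g : α → ℝ := fun x => indic B x - μ.real B with hg
  have hgi : Integrable g μ := by
    refine Integrable.sub ?_ (integrable_const _)
    exact (integrable_const (1 : ℝ)).indicator hB
  have hgA : ∀ A, MeasurableSet[m] A → |∫ x in A, μ[g|m] x ∂μ| ≤ a := by
    intro A hA
    rw [setIntegral_condExp hm hgi hA]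
    have : ∫ x in A, g x ∂μ = μ.real (A ∩ B) - μ.real A * μ.real B := by
      rw [hg, integral_sub]
      · rw [integral_indic _ hB, measureReal_restrict_apply hB, inter_comm]
        simp
      · exact ((integrable_const (1 : ℝ)).indicator hB).integrableOn
      · exact integrable_const _
    rw [this]
    exact ha A hA
  have hM0 : 0 ≤ M := by
    have : Nonempty α := by
      by_contra h
      rw [not_nonempty_iff] at h
      have h1 : μ univ = 1 := measure_univ
      rw [univ_eq_empty_iff.2 h] at h1
      simp at h1
    exact (abs_nonneg _).trans (hM (Classical.arbitrary α))
  have hpull : μ[f * g | m] =ᵐ[μ] f * μ[g | m] :=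
    condExp_stronglyMeasurable_mul_of_bound hm hf.stronglyMeasurable hgi M
      (Eventually.of_forall hM)
  have h1 : ∫ x, f x * g x ∂μ = ∫ x, f x * μ[g|m] x ∂μ := by
    have := integral_condExp (μ := μ) (f := f * g) hm
    rw [integral_congr_ae hpull] at this
    exact this.symm
  set W := μ[g|m] with hW
  have hWi : Integrable W μ := integrable_condExp
  have hWm : Measurable[m] W := stronglyMeasurable_condExp.measurable
  have hS : MeasurableSet[m] {x | 0 ≤ W x} := hWm measurableSet_Ici
  have h2 : ∫ x, |W x| ∂μ ≤ 2 * a := by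
    rw [← integral_add_compl (hm _ hS) hWi.abs]
    have e1 : ∫ x in {x | 0 ≤ W x}, |W x| ∂μ = ∫ x in {x | 0 ≤ W x}, W x ∂μ :=
      setIntegral_congr_fun (hm _ hS) fun x hx => abs_of_nonneg hx
    have e2 : ∫ x in {x | 0 ≤ W x}ᶜ, |W x| ∂μ = - ∫ x in {x | 0 ≤ W x}ᶜ, W x ∂μ := by
      rw [← integral_neg]
      exact setIntegral_congr_fun (hm _ hS).compl fun x hx => abs_of_neg (not_le.1 hx)
    rw [e1, e2]
    have b1 := abs_le.1 (hgA _ hS)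
    have b2 := abs_le.1 (hgA _ hS.compl)
    linarith [b1.2, b2.1]
  rw [h1]
  calc |∫ x, f x * W x ∂μ| ≤ ∫ x, |f x * W x| ∂μ := abs_integral_le_integral_abs
    _ ≤ ∫ x, M * |W x| ∂μ := by
        apply integral_mono_of_nonneg
        · exact Eventually.of_forall fun x => abs_nonneg _
        · exact hWi.abs.const_mul M
        · refine Eventually.of_forall fun x => ?_
          simp only [abs_mul]
          exact mul_le_mul_of_nonneg_right (hM x) (abs_nonneg _)
    _ = M * ∫ x, |W x| ∂μ := integral_const_mul _ _
    _ ≤ M * (2 * a) := mul_le_mul_of_nonneg_left h2 hM0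
    _ = 2 * M * a := by ring

lemma sum_inv_factorial_add_two_le (n : ℕ) :
    ∑ i ∈ Finset.range n, (1 : ℝ) / ((i + 2).factorial : ℝ) ≤ 1 - 1 / ((n + 1).factorial : ℝ) := by
  induction n with
  | zero => simp
  | succ n ih =>
    rw [Finset.sum_range_succ]
    have h1 : ((n + 1 + 1).factorial : ℝ) = ((n : ℝ) + 2) * ((n + 1).factorial : ℝ) := by
      rw [Nat.factorial_succ (n + 1)]; push_cast; ring
    have h2 : (0 : ℝ) < ((n + 1).factorial : ℝ) := by exact_mod_cast Nat.factorial_pos _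
    have h3 : 2 * (1 / ((n + 1 + 1).factorial : ℝ)) ≤ 1 / ((n + 1).factorial : ℝ) := by
      rw [h1, mul_one_div, div_le_div_iff₀ (by positivity) h2]
      nlinarith [Nat.cast_nonneg (α := ℝ) n]
    linarith

/-- Truncated moment generating functions of sums of nearly uncorrelated centred variables:
bound for the top moment. -/
lemma abs_moment_le_of_recursion {N R : ℕ} (hR : 1 ≤ R) (m z : ℕ → ℕ → ℝ) {p l e : ℝ}
    (hl : 0 < l) (hl1 : l ≤ 1) (hp : 0 ≤ p) (he : 0 ≤ e)
    (hNp : N * (p * l ^ 2) ≤ 1) (hNe : N * ((R + 1) * e) ≤ 1)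
    (hm0 : m 0 0 = 1) (hm1 : ∀ r, r ≠ 0 → m 0 r = 0)
    (hz0 : ∀ k < N, z k 0 = 1) (hz1 : ∀ k < N, z k 1 = 0)
    (hz2 : ∀ k < N, ∀ b, 2 ≤ b → |z k b| ≤ p)
    (hstep : ∀ k < N, ∀ r ≤ R, |m (k + 1) r
      - ∑ b ∈ Finset.range (r + 1), (r.choose b : ℝ) * (m k (r - b) * z k b)| ≤ e) :
    |m N R| ≤ 6 * (R.factorial : ℝ) * (1 / l) ^ R := by
  set F : ℕ → ℕ → ℝ := fun k r => l ^ r / (r.factorial : ℝ) * |m k r| with hF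
  set Φ : ℕ → ℝ := fun k => ∑ r ∈ Finset.range (R + 1), F k r with hΦ
  have hF0 : ∀ k r, 0 ≤ F k r := fun k r => by positivity
  have hrec : ∀ k < N, Φ (k + 1) ≤ Φ k * (1 + p * l ^ 2) + (R + 1) * e := by
    intro k hk
    set G : ℕ → ℝ := fun b => l ^ b / (b.factorial : ℝ) * |z k b| with hG
    have hG0 : ∀ b, 0 ≤ G b := fun b => by positivity
    have hGsum : ∑ b ∈ Finset.range (R + 1), G b ≤ 1 + p * l ^ 2 := by
      obtain ⟨R', rfl⟩ : ∃ R', R = R' + 1 := ⟨R - 1, by omega⟩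
      rw [Finset.sum_range_succ', Finset.sum_range_succ']
      have e0 : G 0 = 1 := by simp [hG, hz0 k hk]
      have e1 : G (0 + 1) = 0 := by simp [hG, hz1 k hk]
      rw [e0, e1]
      have : ∑ b ∈ Finset.range R', G (b + 1 + 1)
          ≤ ∑ b ∈ Finset.range R', p * l ^ 2 * (1 / ((b + 2).factorial : ℝ)) := by
        apply Finset.sum_le_sum
        intro b _
        have hz := hz2 k hk (b + 1 + 1) (by omega)
        have hlb : l ^ (b + 1 + 1) ≤ l ^ 2 := pow_le_pow_of_le_one hl.le hl1 (by omega)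
        have hf : (0 : ℝ) < ((b + 2).factorial : ℝ) := by exact_mod_cast Nat.factorial_pos _
        calc G (b + 1 + 1) = l ^ (b + 1 + 1) * |z k (b + 1 + 1)| * (1 / ((b + 2).factorial : ℝ)) := by
              simp only [hG]; ring
          _ ≤ (l ^ 2 * p) * (1 / ((b + 2).factorial : ℝ)) := by gcongr
          _ = _ := by ring
      rw [← Finset.mul_sum] at this
      have h2 := sum_inv_factorial_add_two_le R'
      have h3 : (0 : ℝ) ≤ 1 / ((R' + 1).factorial : ℝ) := by positivity
      have h4 : p * l ^ 2 * ∑ b ∈ Finset.range R', (1 / ((b + 2).factorial : ℝ)) ≤ p * l ^ 2 * 1 :=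
        mul_le_mul_of_nonneg_left (by linarith) (by positivity)
      linarith
    have h1 : ∀ r ∈ Finset.range (R + 1), F (k + 1) r ≤
        ∑ b ∈ Finset.range (r + 1), G b * F k (r - b) + e := by
      intro r hr
      have hrR : r ≤ R := by simpa [Nat.lt_succ_iff] using hr
      have hs := hstep k hk r hrR
      have hf : (0 : ℝ) < (r.factorial : ℝ) := by exact_mod_cast Nat.factorial_pos _
      have hf1 : (1 : ℝ) ≤ (r.factorial : ℝ) := by exact_mod_cast Nat.factorial_pos _
      have hlr : l ^ r / (r.factorial : ℝ) ≤ 1 := by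
        rw [div_le_one hf]
        exact (pow_le_one₀ hl.le hl1).trans hf1
      have habs : |m (k + 1) r| ≤
          ∑ b ∈ Finset.range (r + 1), (r.choose b : ℝ) * (|m k (r - b)| * |z k b|) + e := by
        have t1 : |∑ b ∈ Finset.range (r + 1), (r.choose b : ℝ) * (m k (r - b) * z k b)| ≤
            ∑ b ∈ Finset.range (r + 1), (r.choose b : ℝ) * (|m k (r - b)| * |z k b|) := by
          refine (Finset.abs_sum_le_sum_abs _ _).trans (le_of_eq ?_)
          refine Finset.sum_congr rfl fun b _ => ?_
          rw [abs_mul, abs_mul, Nat.abs_cast]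
        have t2 := abs_sub_abs_le_abs_sub (m (k + 1) r)
          (∑ b ∈ Finset.range (r + 1), (r.choose b : ℝ) * (m k (r - b) * z k b))
        linarith
      calc F (k + 1) r ≤ l ^ r / (r.factorial : ℝ) *
            (∑ b ∈ Finset.range (r + 1), (r.choose b : ℝ) * (|m k (r - b)| * |z k b|) + e) := by
            simp only [hF]; gcongr
        _ = ∑ b ∈ Finset.range (r + 1), l ^ r / (r.factorial : ℝ) *
              ((r.choose b : ℝ) * (|m k (r - b)| * |z k b|)) + l ^ r / (r.factorial : ℝ) * e := by
            rw [mul_add, Finset.mul_sum]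
        _ ≤ _ := by
            apply add_le_add
            · refine le_of_eq (Finset.sum_congr rfl fun b hb => ?_)
              have hbr : b ≤ r := by simpa [Nat.lt_succ_iff] using hb
              have hc := Nat.choose_mul_factorial_mul_factorial hbr
              have hc' : (r.choose b : ℝ) * (b.factorial : ℝ) * ((r - b).factorial : ℝ)
                  = (r.factorial : ℝ) := by exact_mod_cast hc
              have p1 : (b.factorial : ℝ) ≠ 0 := by exact_mod_cast Nat.factorial_ne_zero _
              have p2 : ((r - b).factorial : ℝ) ≠ 0 := by exact_mod_cast Nat.factorial_ne_zero _
              have p3 : (r.choose b : ℝ) ≠ 0 := by exact_mod_cast (Nat.choose_pos hbr).ne'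
              have hpow : l ^ r = l ^ b * l ^ (r - b) := by
                rw [← pow_add]; congr 1; omega
              simp only [hG, hF]
              rw [← hc', hpow]
              field_simp
            · nlinarith
    calc Φ (k + 1) ≤ ∑ r ∈ Finset.range (R + 1),
          (∑ b ∈ Finset.range (r + 1), G b * F k (r - b) + e) := Finset.sum_le_sum h1
      _ = ∑ r ∈ Finset.range (R + 1), ∑ b ∈ Finset.range (r + 1), G b * F k (r - b)
            + (R + 1) * e := by
          rw [Finset.sum_add_distrib]; simp
      _ = ∑ b ∈ Finset.range (R + 1), ∑ i ∈ Finset.range (R + 1 - b), G b * F k i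
            + (R + 1) * e := by
          rw [Finset.sum_range_diag_flip (R + 1) (fun b i => G b * F k i)]
      _ ≤ ∑ b ∈ Finset.range (R + 1), G b * Φ k + (R + 1) * e := by
          gcongr with b hb
          rw [← Finset.mul_sum]
          refine mul_le_mul_of_nonneg_left ?_ (hG0 b)
          exact Finset.sum_le_sum_of_subset_of_nonneg
            (Finset.range_mono (by omega)) fun i _ _ => hF0 k i
      _ = Φ k * (∑ b ∈ Finset.range (R + 1), G b) + (R + 1) * e := by
          rw [← Finset.sum_mul]; ring
      _ ≤ _ := by
          have : 0 ≤ Φ k := Finset.sum_nonneg fun i _ => hF0 k i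
          gcongr
  have hΦ0 : Φ 0 = 1 := by
    simp only [hΦ]
    rw [Finset.sum_range_succ', Finset.sum_eq_zero]
    · simp [hF, hm0]
    · intro r _
      simp [hF, hm1 (r + 1) (by omega)]
  have hx : (1 : ℝ) ≤ 1 + p * l ^ 2 := by nlinarith [mul_nonneg hp (sq_nonneg l)]
  have hind : ∀ k ≤ N, Φ k ≤ (1 + p * l ^ 2) ^ k * (1 + k * ((R + 1) * e)) := by
    intro k
    induction k with
    | zero => intro _; simp [hΦ0]
    | succ k ih =>
      intro hk
      have h1 := hrec k (by omega)
      have h2 := ih (by omega)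
      have h3 : (1 : ℝ) ≤ (1 + p * l ^ 2) ^ (k + 1) := one_le_pow₀ hx
      have h4 : 0 ≤ ((R : ℝ) + 1) * e := by positivity
      calc Φ (k + 1) ≤ Φ k * (1 + p * l ^ 2) + (R + 1) * e := h1
        _ ≤ ((1 + p * l ^ 2) ^ k * (1 + k * ((R + 1) * e))) * (1 + p * l ^ 2)
              + (1 + p * l ^ 2) ^ (k + 1) * ((R + 1) * e) := by
            exact add_le_add (mul_le_mul_of_nonneg_right h2 (by positivity))
              (le_mul_of_one_le_left h4 h3)
        _ = _ := by push_cast; ring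
  have hN := hind N le_rfl
  have hexp : (1 + p * l ^ 2) ^ N ≤ 3 := by
    calc (1 + p * l ^ 2) ^ N ≤ (Real.exp (p * l ^ 2)) ^ N := by
          gcongr
          linarith [Real.add_one_le_exp (p * l ^ 2)]
      _ = Real.exp (N * (p * l ^ 2)) := by rw [← Real.exp_nat_mul]
      _ ≤ Real.exp 1 := Real.exp_le_exp.2 hNp
      _ ≤ 3 := by linarith [Real.exp_one_lt_d9]
  have hΦN : Φ N ≤ 6 := by
    have : (1 + p * l ^ 2) ^ N * (1 + N * ((R + 1) * e)) ≤ 3 * (1 + 1) := by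
      gcongr
    linarith
  have hFN : F N R ≤ 6 :=
    (Finset.single_le_sum (f := F N) (fun i _ => hF0 N i) (by simp)).trans hΦN
  have hf : (0 : ℝ) < (R.factorial : ℝ) := by exact_mod_cast Nat.factorial_pos _
  have hlR : 0 < l ^ R := by positivity
  simp only [hF] at hFN
  rw [div_mul_eq_mul_div, div_le_iff₀ hf] at hFN
  rw [one_div, inv_pow, ← div_eq_mul_inv, le_div_iff₀ hlR]
  linarith

lemma mixSigma_le {X : ℤ → Ω → E} (hX : ∀ i, Measurable (X i)) (S : Set ℤ) :
    mixSigma X S ≤ (inferInstance : MeasurableSpace Ω) :=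
  iSup₂_le fun i _ => (hX i).comap_le

lemma measurable_mixSigma {α : Type*} (X : ℤ → α → E) {S : Set ℤ} {i : ℤ} (hi : i ∈ S) :
    Measurable[mixSigma X S] (X i) := by
  rw [measurable_iff_comap_le]
  exact le_iSup₂_of_le i hi le_rfl

lemma abs_sub_le_alphaMix (P : Measure Ω) [IsProbabilityMeasure P] (X : ℤ → Ω → E) (k : ℕ) (i : ℤ)
    {A B : Set Ω} (hA : MeasurableSet[mixSigma X (Set.Iic i)] A)
    (hB : MeasurableSet[mixSigma X (Set.Ici (i + (k : ℤ)))] B) :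
    |P.real (A ∩ B) - P.real A * P.real B| ≤ alphaMix P X k := by
  refine le_csSup ⟨1, ?_⟩ ⟨i, A, B, hA, hB, rfl⟩
  rintro r ⟨i, A, B, -, -, rfl⟩
  change |P.real (A ∩ B) - P.real A * P.real B| ≤ 1
  have h1 := measureReal_le_one (μ := P) (s := A ∩ B)
  have h2 := measureReal_le_one (μ := P) (s := A)
  have h3 := measureReal_le_one (μ := P) (s := B)
  have h4 : 0 ≤ P.real (A ∩ B) := measureReal_nonneg
  have h5 : 0 ≤ P.real A := measureReal_nonneg
  have h6 : 0 ≤ P.real B := measureReal_nonneg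
  rw [abs_le]
  constructor <;> nlinarith

lemma alphaMix_nonneg (P : Measure Ω) [IsProbabilityMeasure P] (X : ℤ → Ω → E) (k : ℕ) :
    0 ≤ alphaMix P X k :=
  (abs_nonneg _).trans (abs_sub_le_alphaMix P X k 0 (A := ∅) (B := ∅)
    (@MeasurableSet.empty _ (mixSigma X _)) (@MeasurableSet.empty _ (mixSigma X _)))

/-- Moment bound for centred indicator sums along indices with gaps at least `q`. -/
lemma abs_moment_gap_le (P : Measure Ω) [IsProbabilityMeasure P] {X : ℤ → Ω → E}
    (hX : ∀ i, Measurable (X i)) {B : Set E} (hB : MeasurableSet B) {p : ℝ}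
    (hp : ∀ i, P.real (X i ⁻¹' B) = p) {t : ℕ → ℤ} {q : ℕ}
    (ht : ∀ k l, l < k → t l + q ≤ t k) {N n R : ℕ} (hR : 1 ≤ R) (hn : 1 ≤ n) (hNn : N ≤ n) {M : ℝ}
    (hM : 1 ≤ M) (hpM : n * p ≤ M ^ 2)
    (hα : n * ((R + 1) * (2 ^ R * (4 * n ^ R * alphaMix P X q))) ≤ 1) :
    |∫ ω, (∑ l ∈ Finset.range N, (indic B (X (t l) ω) - p)) ^ R ∂P|
      ≤ 6 * (R.factorial : ℝ) * M ^ R := by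
  have hp0 : 0 ≤ p := hp 0 ▸ measureReal_nonneg
  have hp1 : p ≤ 1 := hp 0 ▸ measureReal_le_one
  set Z : ℕ → Ω → ℝ := fun l ω => indic B (X (t l) ω) - p with hZ
  set S : ℕ → Ω → ℝ := fun k ω => ∑ l ∈ Finset.range k, Z l ω with hS
  have hZm : ∀ l, Measurable (Z l) := fun l =>
    ((measurable_indic hB).comp (hX _)).sub_const p
  have hSm : ∀ k, Measurable (S k) := fun k => Finset.measurable_fun_sum _ fun l _ => hZm l
  have hZb : ∀ l ω, |Z l ω| ≤ 1 := by
    intro l ω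
    rw [abs_le]
    rcases indic_mem B (X (t l) ω) with h | h <;> simp only [hZ, h.1] <;> constructor <;> linarith
  have hSb : ∀ k ≤ N, ∀ ω, |S k ω| ≤ n := by
    intro k hk ω
    calc |S k ω| ≤ ∑ l ∈ Finset.range k, |Z l ω| := Finset.abs_sum_le_sum_abs _ _
      _ ≤ ∑ l ∈ Finset.range k, (1 : ℝ) := Finset.sum_le_sum fun l _ => hZb l ω
      _ = k := by simp
      _ ≤ n := by exact_mod_cast hk.trans hNn
  have hbdd : ∀ {f : Ω → ℝ} (_ : Measurable f) (c : ℝ) (_ : ∀ ω, |f ω| ≤ c), Integrable f P :=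
    fun hf c hc => Integrable.of_bound hf.aestronglyMeasurable c (Eventually.of_forall hc)
  have hn1 : (1 : ℝ) ≤ n := by exact_mod_cast hn
  have hprod : ∀ k ≤ N, ∀ a b, ∀ ω, |S k ω ^ a * Z k ω ^ b| ≤ (n : ℝ) ^ a := by
    intro k hk a b ω
    rw [abs_mul, abs_pow, abs_pow]
    have h1 : |S k ω| ^ a ≤ (n : ℝ) ^ a := pow_le_pow_left₀ (abs_nonneg _) (hSb k hk ω) a
    have h2 : |Z k ω| ^ b ≤ 1 := pow_le_one₀ (abs_nonneg _) (hZb k ω)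
    calc _ ≤ (n : ℝ) ^ a * 1 := by gcongr
      _ = _ := mul_one _
  have hprodi : ∀ k ≤ N, ∀ a b, Integrable (fun ω => S k ω ^ a * Z k ω ^ b) P := fun k hk a b =>
    hbdd (((hSm k).pow_const a).mul ((hZm k).pow_const b)) _ (hprod k hk a b)
  have hpre : ∀ l, MeasurableSet (X (t l) ⁻¹' B) := fun l => hX _ hB
  have hZpow : ∀ l b ω, Z l ω ^ b =
      ((1 - p) ^ b - (-p) ^ b) * indic (X (t l) ⁻¹' B) ω + (-p) ^ b := by
    intro l b ω
    have e : indic (X (t l) ⁻¹' B) ω = indic B (X (t l) ω) := rfl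
    rcases indic_mem B (X (t l) ω) with h | h <;> simp only [hZ, e, h.1] <;> ring
  have h_integral : ∀ l, ∫ ω, indic (X (t l) ⁻¹' B) ω ∂P = p := fun l => by
    rw [integral_indic P (hpre l), hp]
  have hindi : ∀ l, Integrable (indic (X (t l) ⁻¹' B)) P := fun l =>
    (integrable_const (1 : ℝ)).indicator (hpre l)
  set e : ℝ := 2 ^ R * (4 * n ^ R * alphaMix P X q) with he
  have hα0 := alphaMix_nonneg P X q
  have hcov : ∀ k ≤ N, ∀ a ≤ R, ∀ b, |∫ ω, S k ω ^ a * Z k ω ^ b ∂P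
      - (∫ ω, S k ω ^ a ∂P) * ∫ ω, Z k ω ^ b ∂P| ≤ 4 * n ^ R * alphaMix P X q := by
    intro k hk a ha b
    have hm := mixSigma_le hX (Set.Iic (t k - q))
    have hSk : Measurable[mixSigma X (Set.Iic (t k - q))] (S k) := by
      refine Finset.measurable_fun_sum _ fun l hl => ?_
      have : t l ∈ Set.Iic (t k - q) := by
        have := ht k l (Finset.mem_range.1 hl)
        simp only [Set.mem_Iic]; omega
      exact ((measurable_indic hB).comp (measurable_mixSigma X this)).sub_const p
    have hBk : MeasurableSet[mixSigma X (Set.Ici (t k - q + (q : ℤ)))] (X (t k) ⁻¹' B) :=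
      measurable_mixSigma X (by simp) hB
    have hSa : ∀ ω, |S k ω ^ a| ≤ (n : ℝ) ^ R := fun ω => by
      rw [abs_pow]
      exact (pow_le_pow_left₀ (abs_nonneg _) (hSb k hk ω) a).trans (pow_le_pow_right₀ hn1 ha)
    have hmain := abs_integral_mul_indic_sub_le hm P (hpre k) (f := fun ω => S k ω ^ a)
      (hSk.pow_const a) hSa (fun A hA => abs_sub_le_alphaMix P X q _ hA hBk)
    rw [hp] at hmain
    have hSi : Integrable (fun ω => S k ω ^ a) P := by simpa using hprodi k hk a 0
    have hSii : Integrable (fun ω => S k ω ^ a * indic (X (t k) ⁻¹' B) ω) P := by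
      refine hbdd (((hSm k).pow_const a).mul (measurable_indic (hpre k))) (n ^ R) fun ω => ?_
      rw [abs_mul]
      have : |indic (X (t k) ⁻¹' B) ω| ≤ 1 := by
        rcases indic_mem (X (t k) ⁻¹' B) ω with h | h <;> simp [h.1]
      calc _ ≤ (n : ℝ) ^ R * 1 := by gcongr; exact hSa ω
        _ = _ := mul_one _
    set c1 : ℝ := (1 - p) ^ b - (-p) ^ b with hc1
    have hc1' : |c1| ≤ 2 := by
      have h1 : |(1 - p) ^ b| ≤ 1 := by
        rw [abs_pow]; exact pow_le_one₀ (abs_nonneg _) (by rw [abs_le]; constructor <;> linarith)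
      have h2 : |(-p) ^ b| ≤ 1 := by
        rw [abs_pow]; exact pow_le_one₀ (abs_nonneg _) (by rw [abs_le]; constructor <;> linarith)
      rw [abs_le] at *
      constructor <;> linarith [h1.1, h1.2, h2.1, h2.2]
    have e1 : ∫ ω, S k ω ^ a * Z k ω ^ b ∂P = c1 * ∫ ω, S k ω ^ a * indic (X (t k) ⁻¹' B) ω ∂P
        + (-p) ^ b * ∫ ω, S k ω ^ a ∂P := by
      rw [← integral_const_mul, ← integral_const_mul, ← integral_add (hSii.const_mul _)
        (hSi.const_mul _)]
      refine integral_congr_ae (Eventually.of_forall fun ω => ?_)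
      simp only [hZpow]; ring
    have e2 : ∫ ω, Z k ω ^ b ∂P = c1 * p + (-p) ^ b := by
      simp only [hZpow]
      rw [integral_add ((hindi k).const_mul _) (integrable_const _), integral_const_mul, h_integral, hc1]
      simp
    have e3 : ∫ ω, S k ω ^ a * (indic (X (t k) ⁻¹' B) ω - p) ∂P
        = ∫ ω, S k ω ^ a * indic (X (t k) ⁻¹' B) ω ∂P - p * ∫ ω, S k ω ^ a ∂P := by
      rw [← integral_const_mul, ← integral_sub hSii (hSi.const_mul _)]
      refine integral_congr_ae (Eventually.of_forall fun ω => ?_)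
      ring
    rw [e3] at hmain
    rw [e1, e2]
    have : c1 * ∫ ω, S k ω ^ a * indic (X (t k) ⁻¹' B) ω ∂P
        + (-p) ^ b * ∫ ω, S k ω ^ a ∂P - (∫ ω, S k ω ^ a ∂P) * (c1 * p + (-p) ^ b)
        = c1 * (∫ ω, S k ω ^ a * indic (X (t k) ⁻¹' B) ω ∂P - p * ∫ ω, S k ω ^ a ∂P) := by ring
    rw [this, abs_mul]
    calc _ ≤ 2 * (2 * n ^ R * alphaMix P X q) := by gcongr
      _ = _ := by ring
  have key := abs_moment_le_of_recursion (N := N) (R := R) hR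
    (fun k r => ∫ ω, S k ω ^ r ∂P) (fun k b => ∫ ω, Z k ω ^ b ∂P) (p := p) (l := 1 / M) (e := e)
    (by positivity) (by rw [div_le_one (by positivity)]; exact hM) hp0 (by positivity)
    (by
      rw [div_pow, one_pow, mul_one_div, mul_div_assoc', div_le_one (by positivity)]
      refine le_trans ?_ hpM
      gcongr)
    (by
      refine le_trans ?_ hα
      gcongr)
    (by simp) (by intro r hr; simp [hS, hr]) (by simp)
    (by
      intro k _
      simp only [pow_one]
      change ∫ ω, (indic (X (t k) ⁻¹' B) ω - p) ∂P = 0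
      rw [integral_sub (hindi k) (integrable_const _), h_integral]
      simp)
    (by
      intro k _ b hb
      have hle : ∀ ω, |Z k ω ^ b| ≤ Z k ω ^ 2 := fun ω => by
        rw [abs_pow, ← sq_abs (Z k ω)]
        exact pow_le_pow_of_le_one (abs_nonneg _) (hZb k ω) hb
      have hi2 : Integrable (fun ω => Z k ω ^ 2) P :=
        hbdd ((hZm k).pow_const 2) 1 fun ω => by
          rw [abs_pow]; exact pow_le_one₀ (abs_nonneg _) (hZb k ω)
      calc |∫ ω, Z k ω ^ b ∂P| ≤ ∫ ω, |Z k ω ^ b| ∂P := abs_integral_le_integral_abs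
        _ ≤ ∫ ω, Z k ω ^ 2 ∂P := integral_mono_of_nonneg
            (Eventually.of_forall fun ω => abs_nonneg _) hi2 (Eventually.of_forall hle)
        _ = (((1 - p) ^ 2 - (-p) ^ 2) * p + (-p) ^ 2) := by
            simp only [hZpow]
            rw [integral_add ((hindi k).const_mul _) (integrable_const _), integral_const_mul, h_integral]
            simp
        _ ≤ p := by nlinarith)
    (by
      intro k hk r hr
      have hadd : ∀ ω, S (k + 1) ω ^ r = ∑ b ∈ Finset.range (r + 1),
          (r.choose b : ℝ) * (S k ω ^ (r - b) * Z k ω ^ b) := by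
        intro ω
        have : S (k + 1) ω = Z k ω + S k ω := by simp [hS, Finset.sum_range_succ, add_comm]
        rw [this, add_pow]
        exact Finset.sum_congr rfl fun b _ => by ring
      simp only [hadd]
      rw [integral_finsetSum _ fun b _ => (hprodi k hk.le _ _).const_mul _, ← Finset.sum_sub_distrib]
      refine (Finset.abs_sum_le_sum_abs _ _).trans ?_
      calc _ ≤ ∑ b ∈ Finset.range (r + 1), (r.choose b : ℝ) * (4 * n ^ R * alphaMix P X q) := by
            refine Finset.sum_le_sum fun b _ => ?_
            rw [integral_const_mul, ← mul_sub, abs_mul, Nat.abs_cast]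
            gcongr
            exact hcov k hk.le _ (by omega) b
        _ = 2 ^ r * (4 * n ^ R * alphaMix P X q) := by
            rw [← Finset.sum_mul]
            congr 1
            exact_mod_cast Nat.sum_range_choose r
        _ ≤ e := by
            simp only [he]
            gcongr
            norm_num)
  rw [one_div_one_div] at key
  exact key

lemma sum_Icc_eq_sum_residues (z : ℤ → ℝ) (n : ℕ) {q : ℕ} (hq : 1 ≤ q) :
    ∑ i ∈ Finset.Icc (1 : ℤ) (n : ℤ), z i =
      ∑ r ∈ Finset.range q, ∑ k ∈ Finset.range ((n + q - 1 - r) / q), z (1 + r + q * k) := by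
  have hkey : ∀ r < q, ∀ k, k < (n + q - 1 - r) / q ↔ r + q * k + 1 ≤ n := by
    intro r hr k
    rw [← Nat.succ_le_iff, Nat.le_div_iff_mul_le (by omega), Nat.succ_mul, mul_comm k q]
    omega
  rw [Finset.sum_sigma']
  symm
  refine Finset.sum_bij' (fun x _ => 1 + (x.1 : ℤ) + q * (x.2 : ℤ))
    (fun i _ => ⟨(i - 1).toNat % q, (i - 1).toNat / q⟩) ?_ ?_ ?_ ?_ ?_
  · rintro ⟨r, k⟩ h
    simp only [Finset.mem_sigma, Finset.mem_range] at h
    have := (hkey r h.1 k).1 h.2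
    simp only [Finset.mem_Icc]
    constructor
    · have : (0 : ℤ) ≤ q * (k : ℤ) := by positivity
      omega
    · have h2 : ((r + q * k + 1 : ℕ) : ℤ) ≤ n := by exact_mod_cast this
      push_cast at h2
      linarith
  · intro i hi
    simp only [Finset.mem_Icc] at hi
    have hr : (i - 1).toNat % q < q := Nat.mod_lt _ (by omega)
    simp only [Finset.mem_sigma, Finset.mem_range]
    refine ⟨hr, (hkey _ hr _).2 ?_⟩
    rw [Nat.mod_add_div]
    omega
  · rintro ⟨r, k⟩ h
    simp only [Finset.mem_sigma, Finset.mem_range] at h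
    have e : (1 + (r : ℤ) + q * (k : ℤ) - 1).toNat = r + q * k := by
      have : (1 + (r : ℤ) + q * (k : ℤ) - 1) = ((r + q * k : ℕ) : ℤ) := by push_cast; ring
      rw [this, Int.toNat_natCast]
    simp only [e, Nat.add_mul_mod_self_left, Nat.mod_eq_of_lt h.1,
      Nat.add_mul_div_left _ _ (by omega : 0 < q), Nat.div_eq_of_lt h.1, zero_add]
  · intro i hi
    simp only [Finset.mem_Icc] at hi
    have h1 := Nat.mod_add_div (i - 1).toNat q
    have h2 : (((i - 1).toNat % q + q * ((i - 1).toNat / q) : ℕ) : ℤ) = i - 1 := by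
      rw [h1, Int.toNat_of_nonneg (by omega)]
    push_cast at h2 ⊢
    linarith
  · intro x _
    rfl

/-- Polynomial tail bound for centred indicator sums under alpha mixing. -/
lemma tail_sum_indic_le (P : Measure Ω) [IsProbabilityMeasure P] {X : ℤ → Ω → E}
    (hX : ∀ i, Measurable (X i)) {B : Set E} (hB : MeasurableSet B) {p : ℝ}
    (hp : ∀ i, P.real (X i ⁻¹' B) = p) {q n m : ℕ} (hq : 1 ≤ q) (hm : 1 ≤ m) (hn : 1 ≤ n) {M y : ℝ}
    (hy : 0 < y) (hM : 1 ≤ M) (hpM : n * p ≤ M ^ 2)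
    (hα : n * (((2 * m : ℕ) + 1) *
      (2 ^ (2 * m) * (4 * n ^ (2 * m) * alphaMix P X q))) ≤ 1) :
    P.real {ω | q * y < |∑ i ∈ Finset.Icc (1 : ℤ) (n : ℤ), (indic B (X i ω) - p)|} ≤
      q * (6 * ((2 * m).factorial : ℝ) * (M / y) ^ (2 * m)) := by
  set N : ℕ → ℕ := fun r => (n + q - 1 - r) / q with hN
  set S : ℕ → Ω → ℝ := fun r ω =>
    ∑ k ∈ Finset.range (N r), (indic B (X (1 + r + q * k) ω) - p) with hS
  have hNn : ∀ r, N r ≤ n := by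
    intro r
    refine Nat.div_le_of_le_mul ?_
    obtain ⟨q', rfl⟩ : ∃ q', q = q' + 1 := ⟨q - 1, by omega⟩
    obtain ⟨n', rfl⟩ : ∃ n', n = n' + 1 := ⟨n - 1, by omega⟩
    have : n' + 1 + (q' + 1) - 1 - r ≤ n' + 1 + q' := by omega
    nlinarith
  have hsub : {ω | q * y < |∑ i ∈ Finset.Icc (1 : ℤ) (n : ℤ), (indic B (X i ω) - p)|} ⊆
      ⋃ r ∈ Finset.range q, {ω | y ^ (2 * m) ≤ (S r ω) ^ (2 * m)} := by
    intro ω hω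
    simp only [Set.mem_ofPred_eq] at hω
    rw [sum_Icc_eq_sum_residues (fun i => indic B (X i ω) - p) n hq] at hω
    by_contra hcon
    simp only [Set.mem_iUnion, Set.mem_ofPred_eq, not_exists, not_le] at hcon
    have : ∀ r ∈ Finset.range q, |S r ω| ≤ y := by
      intro r hr
      by_contra h
      have h1 := hcon r hr
      have h2 : y ^ (2 * m) ≤ |S r ω| ^ (2 * m) := pow_le_pow_left₀ hy.le (not_le.1 h).le _
      rw [(even_two_mul m).pow_abs] at h2
      linarith
    have h3 := (Finset.abs_sum_le_sum_abs (fun r => S r ω) (Finset.range q)).trans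
      (Finset.sum_le_sum this)
    simp only [Finset.sum_const, Finset.card_range, nsmul_eq_mul] at h3
    simp only [hS] at h3
    linarith
  refine (measureReal_mono hsub (measure_ne_top _ _)).trans ((measureReal_biUnion_finset_le _ _).trans ?_)
  calc _ ≤ ∑ r ∈ Finset.range q, 6 * ((2 * m).factorial : ℝ) * (M / y) ^ (2 * m) := by
        refine Finset.sum_le_sum fun r _ => ?_
        have hmom := abs_moment_gap_le P hX hB hp (t := fun k => 1 + r + q * k) (q := q)
          (by
            intro k l hlk
            have : (q : ℤ) * (l + 1) ≤ q * k :=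
              mul_le_mul_of_nonneg_left (by exact_mod_cast hlk) (by positivity)
            linarith) (N := N r) (n := n) (R := 2 * m) (by omega) hn (hNn r) hM hpM hα
        have hSm : Measurable (S r) := Finset.measurable_fun_sum _ fun k _ =>
          ((measurable_indic hB).comp (hX _)).sub_const p
        have hp0 : 0 ≤ p := hp 0 ▸ measureReal_nonneg
        have hp1 : p ≤ 1 := hp 0 ▸ measureReal_le_one
        have hSi : Integrable (fun ω => S r ω ^ (2 * m)) P := by
          refine Integrable.of_bound (hSm.pow_const _).aestronglyMeasurable ((n : ℝ) ^ (2 * m))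
            (Eventually.of_forall fun ω => ?_)
          rw [Real.norm_eq_abs, abs_pow]
          refine pow_le_pow_left₀ (abs_nonneg _) ?_ _
          calc |S r ω| ≤ ∑ k ∈ Finset.range (N r), |indic B (X (1 + r + q * k) ω) - p| :=
                Finset.abs_sum_le_sum_abs _ _
            _ ≤ ∑ k ∈ Finset.range (N r), (1 : ℝ) := by
                refine Finset.sum_le_sum fun k _ => ?_
                rw [abs_le]
                rcases indic_mem B (X (1 + r + q * k) ω) with h | h <;> simp only [h.1] <;>
                  constructor <;> linarith
            _ = N r := by simp
            _ ≤ n := by exact_mod_cast hNn r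
        have hmk := mul_meas_ge_le_integral_of_nonneg (μ := P) (f := fun ω => S r ω ^ (2 * m))
          (Eventually.of_forall fun ω => (even_two_mul m).pow_nonneg _) hSi (y ^ (2 * m))
        have hy' : 0 < y ^ (2 * m) := by positivity
        rw [div_pow, mul_div_assoc', le_div_iff₀ hy', mul_comm]
        exact hmk.trans ((le_abs_self _).trans hmom)
    _ = _ := by simp

lemma tendsto_rpow_mul_exp_neg_rpow {b s : ℝ} (hb : 0 < b) (hs : 0 < s) (k : ℕ) :
    Tendsto (fun n : ℕ => (n : ℝ) ^ k * Real.exp (-b * (n : ℝ) ^ s)) atTop (nhds 0) := by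
  have h1 := (tendsto_rpow_mul_exp_neg_mul_atTop_nhds_zero (k / s) b hb).comp
    ((tendsto_rpow_atTop hs).comp tendsto_natCast_atTop_atTop)
  refine h1.congr fun n => ?_
  simp only [Function.comp_apply]
  rw [← Real.rpow_mul (Nat.cast_nonneg n), mul_div_cancel₀ _ hs.ne', Real.rpow_natCast]

lemma eventually_mul_pow_mul_alphaMix_le_one (P : Measure Ω) [IsProbabilityMeasure P]
    {X : ℤ → Ω → E} (hmix : ExpAlphaMixing P X) {s : ℝ} (hs : 0 < s) (K : ℝ) (k : ℕ) :
    ∀ᶠ n : ℕ in atTop, K * (n : ℝ) ^ k * alphaMix P X ⌈(n : ℝ) ^ s⌉₊ ≤ 1 := by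
  obtain ⟨a, ⟨ha0, ha1⟩, c, hc⟩ := hmix
  have hlog : 0 < -Real.log a := neg_pos.2 (Real.log_neg ha0 ha1)
  have h1 := (tendsto_rpow_mul_exp_neg_rpow hlog hs k).const_mul (|K| * |c|)
  rw [mul_zero] at h1
  filter_upwards [h1.eventually_le_const one_pos, eventually_ge_atTop 1] with n hn hn1
  have hn1' : (1 : ℝ) ≤ n := by exact_mod_cast hn1
  set q := ⌈(n : ℝ) ^ s⌉₊ with hq
  have hq1 : 1 ≤ q := Nat.one_le_ceil_iff.2 (by positivity)
  have hα := hc q hq1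
  have haq : a ^ q ≤ Real.exp (Real.log a * (n : ℝ) ^ s) := by
    rw [← Real.rpow_natCast, Real.rpow_def_of_pos ha0]
    refine Real.exp_le_exp.2 (mul_le_mul_of_nonpos_left (Nat.le_ceil _) ?_)
    linarith
  have hα0 := alphaMix_nonneg P X q
  calc K * (n : ℝ) ^ k * alphaMix P X q ≤ |K| * (n : ℝ) ^ k * alphaMix P X q := by
        gcongr; exact le_abs_self K
    _ ≤ |K| * (n : ℝ) ^ k * (|c| * Real.exp (Real.log a * (n : ℝ) ^ s)) := by
        refine mul_le_mul_of_nonneg_left ?_ (by positivity)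
        refine hα.trans ?_
        exact mul_le_mul (le_abs_self c) haq (by positivity) (abs_nonneg c)
    _ = |K| * |c| * ((n : ℝ) ^ k * Real.exp (- -Real.log a * (n : ℝ) ^ s)) := by
        rw [neg_neg]; ring
    _ ≤ 1 := hn

/-- Uniform tail bound for empirical frequencies of events under exponential alpha mixing. -/
lemma exists_tail_emp_le (P : Measure Ω) [IsProbabilityMeasure P] {X : ℤ → Ω → E}
    (hX : ∀ i, Measurable (X i)) (hmix : ExpAlphaMixing P X) {s : ℝ} (hs : 0 < s) (L : ℕ) :
    ∃ C : ℝ, ∀ᶠ n : ℕ in atTop, ∀ B : Set E, MeasurableSet B → ∀ p : ℝ,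
      (∀ i, P.real (X i ⁻¹' B) = p) →
      P.real {ω | (n : ℝ) ^ (s - 1) * max 1 √(n * p) <
        |(n : ℝ)⁻¹ * ∑ i ∈ Finset.Icc (1 : ℤ) (n : ℤ), indic B (X i ω) - p|} ≤ C * (n : ℝ) ^ (-L : ℝ) := by
  set m : ℕ := ⌈(L + s) / s⌉₊ with hm
  have hm1 : 1 ≤ m := Nat.one_le_ceil_iff.2 (by positivity)
  have hms : L + s ≤ s * m := by
    have := Nat.le_ceil ((L + s) / s)
    rw [div_le_iff₀ hs] at this
    linarith
  refine ⟨2 * (6 * ((2 * m).factorial : ℝ) * 2 ^ (2 * m)), ?_⟩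
  filter_upwards [eventually_mul_pow_mul_alphaMix_le_one P hmix (half_pos hs)
    (((2 * m : ℕ) + 1) * (2 ^ (2 * m) * 4)) (2 * m + 1), eventually_ge_atTop 1] with n hα hn B hB p hp
  have hn1 : (1 : ℝ) ≤ n := by exact_mod_cast hn
  have hn0 : (0 : ℝ) < n := by linarith
  set q := ⌈(n : ℝ) ^ (s / 2)⌉₊ with hq
  have hq1 : 1 ≤ q := Nat.one_le_ceil_iff.2 (by positivity)
  have hq0 : (0 : ℝ) < q := by exact_mod_cast hq1
  have hns1 : 1 ≤ (n : ℝ) ^ (s / 2) := Real.one_le_rpow hn1 (by positivity)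
  have hq2 : (q : ℝ) ≤ 2 * (n : ℝ) ^ (s / 2) := by
    have := Nat.ceil_lt_add_one (a := (n : ℝ) ^ (s / 2)) (by positivity)
    linarith
  have hp0 : 0 ≤ p := hp 0 ▸ measureReal_nonneg
  set M : ℝ := max 1 √(n * p) with hM
  have hM1 : 1 ≤ M := le_max_left _ _
  have hpM : n * p ≤ M ^ 2 := by
    rw [← Real.sq_sqrt (by positivity : 0 ≤ n * p)]
    exact pow_le_pow_left₀ (Real.sqrt_nonneg _) (le_max_right _ _) 2
  have htail := tail_sum_indic_le P hX hB hp (q := q) (n := n) (m := m) hq1 hm1 hn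
    (M := M) (y := (n : ℝ) ^ s * M / q) (by positivity) hM1 hpM
    (by refine le_trans (le_of_eq ?_) hα; push_cast; ring)
  have hset : {ω | (n : ℝ) ^ (s - 1) * M <
        |(n : ℝ)⁻¹ * ∑ i ∈ Finset.Icc (1 : ℤ) (n : ℤ), indic B (X i ω) - p|} =
      {ω | q * ((n : ℝ) ^ s * M / q) < |∑ i ∈ Finset.Icc (1 : ℤ) (n : ℤ), (indic B (X i ω) - p)|} := by
    ext ω
    have e1 : (n : ℝ)⁻¹ * ∑ i ∈ Finset.Icc (1 : ℤ) (n : ℤ), indic B (X i ω) - p =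
        (n : ℝ)⁻¹ * ∑ i ∈ Finset.Icc (1 : ℤ) (n : ℤ), (indic B (X i ω) - p) := by
      rw [Finset.sum_sub_distrib]
      simp only [Finset.sum_const, Int.card_Icc, add_sub_cancel_right, Int.toNat_natCast,
        nsmul_eq_mul]
      field_simp
    simp only [Set.mem_ofPred_eq]
    rw [e1, abs_mul, abs_of_pos (inv_pos.2 hn0), Real.rpow_sub hn0, Real.rpow_one,
      mul_div_cancel₀ _ hq0.ne', ← div_eq_inv_mul, lt_div_iff₀ hn0]
    have : (n : ℝ) ^ s / n * M * n = (n : ℝ) ^ s * M := by field_simp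
    rw [this]
  rw [hset]
  refine htail.trans ?_
  have e2 : M / ((n : ℝ) ^ s * M / q) = q / (n : ℝ) ^ s := by
    field_simp
  rw [e2]
  have e3 : q / (n : ℝ) ^ s ≤ 2 * (n : ℝ) ^ (-(s / 2)) := by
    rw [div_le_iff₀ (by positivity), mul_assoc, ← Real.rpow_add hn0]
    refine hq2.trans (le_of_eq ?_)
    congr 2; ring
  calc q * (6 * ((2 * m).factorial : ℝ) * (q / (n : ℝ) ^ s) ^ (2 * m))
      ≤ (2 * (n : ℝ) ^ (s / 2)) * (6 * ((2 * m).factorial : ℝ) *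
        (2 * (n : ℝ) ^ (-(s / 2))) ^ (2 * m)) := by gcongr
    _ = 2 * (6 * ((2 * m).factorial : ℝ) * 2 ^ (2 * m)) * (n : ℝ) ^ (s / 2 - s * m) := by
        rw [mul_pow, ← Real.rpow_natCast ((n : ℝ) ^ (-(s / 2))), ← Real.rpow_mul hn0.le,
          sub_eq_add_neg, Real.rpow_add hn0]
        have : -(s / 2) * ((2 * m : ℕ) : ℝ) = -(s * m) := by push_cast; ring
        rw [this]; ring
    _ ≤ _ := by
        refine mul_le_mul_of_nonneg_left ?_ (by positivity)
        exact Real.rpow_le_rpow_of_exponent_le hn1 (by linarith)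

/-- The coordinatewise probability integral transform. -/
def margTransform (P : Measure Ω) (X : ℤ → Ω → Fin d → ℝ) (x : Fin d → ℝ) (j : Fin d) : ℝ :=
  margF P X j (x j)

lemma measurable_margTransform {P : Measure Ω} {X : ℤ → Ω → Fin d → ℝ}
    (hcont : ∀ j, Continuous (margF P X j)) : Measurable (margTransform P X) :=
  measurable_pi_lambda _ fun j => (hcont j).measurable.comp (measurable_pi_apply j)

lemma measureReal_preimage_eq_of_stationary {P : Measure Ω} {X : ℤ → Ω → E}
    (hmeas : ∀ i, Measurable (X i)) (hstat : StrictlyStationary P X) {B : Set E}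
    (hB : MeasurableSet B) (i : ℤ) : P.real (X i ⁻¹' B) = P.real (X 0 ⁻¹' B) := by
  have h := congrArg (fun ν : Measure (Fin 1 → E) => ν.real ((fun f => f 0) ⁻¹' B))
    (hstat 1 (fun _ => 0) i)
  simp only [zero_add] at h
  rw [map_measureReal_apply (measurable_pi_lambda _ fun _ => hmeas i) (measurable_pi_apply 0 hB),
    map_measureReal_apply (measurable_pi_lambda _ fun _ => hmeas 0) (measurable_pi_apply 0 hB)] at h
  exact h

lemma margF_mem_Icc (P : Measure Ω) [IsProbabilityMeasure P] (X : ℤ → Ω → Fin d → ℝ) (j : Fin d)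
    (x : ℝ) : margF P X j x ∈ Icc (0 : ℝ) 1 :=
  ⟨ENNReal.toReal_nonneg, measureReal_le_one⟩

lemma Uv_mem_Icc (P : Measure Ω) [IsProbabilityMeasure P] (X : ℤ → Ω → Fin d → ℝ) (i : ℤ) (ω : Ω)
    (j : Fin d) : Uv P X i ω j ∈ Icc (0 : ℝ) 1 :=
  margF_mem_Icc P X j _

lemma monotone_margF (P : Measure Ω) [IsProbabilityMeasure P] (X : ℤ → Ω → Fin d → ℝ)
    (j : Fin d) : Monotone (margF P X j) := fun _ _ hxy =>
  measureReal_mono (fun _ hω => le_trans hω hxy)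

lemma exists_margF_eq {P : Measure Ω} [IsProbabilityMeasure P] {X : ℤ → Ω → Fin d → ℝ}
    (hmeas : Measurable (X 0)) {j : Fin d} (hcont : Continuous (margF P X j)) {s : ℝ}
    (hs : s ∈ Ioo (0 : ℝ) 1) : ∃ t, margF P X j t = s := by
  have hm : Measurable fun ω => X 0 ω j := (measurable_pi_apply j).comp hmeas
  have : IsProbabilityMeasure (P.map fun ω => X 0 ω j) :=
    Measure.isProbabilityMeasure_map hm.aemeasurable
  have hF : margF P X j = ProbabilityTheory.cdf (P.map fun ω => X 0 ω j) := by
    ext t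
    rw [ProbabilityTheory.cdf_eq_real, map_measureReal_apply hm measurableSet_Iic]
    rfl
  have h0 := ProbabilityTheory.tendsto_cdf_atBot (P.map fun ω => X 0 ω j)
  have h1 := ProbabilityTheory.tendsto_cdf_atTop (P.map fun ω => X 0 ω j)
  rw [← hF] at h0 h1
  obtain ⟨a, ha⟩ := (h0.eventually (gt_mem_nhds hs.1)).exists
  obtain ⟨b, hb⟩ := (h1.eventually (lt_mem_nhds hs.2)).exists
  obtain ⟨t, ht⟩ := mem_range_of_exists_le_of_exists_ge hcont ⟨a, ha.le⟩ ⟨b, hb.le⟩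
  exact ⟨t, ht⟩

/-- The probability integral transform of a continuous marginal is uniform. -/
lemma measureReal_Uv_le {P : Measure Ω} [IsProbabilityMeasure P] {X : ℤ → Ω → Fin d → ℝ}
    (hmeas : Measurable (X 0)) {j : Fin d} (hcont : Continuous (margF P X j)) {s : ℝ}
    (hs : s ∈ Icc (0 : ℝ) 1) : P.real {ω | Uv P X 0 ω j ≤ s} = s := by
  apply le_antisymm
  · rcases eq_or_lt_of_le hs.2 with rfl | hs1
    · exact measureReal_le_one
    refine le_of_forall_gt_imp_ge_of_dense fun s' hs' => ?_
    rcases le_or_gt 1 s' with h1 | h1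
    · exact measureReal_le_one.trans h1
    obtain ⟨t, ht⟩ := exists_margF_eq hmeas hcont ⟨hs.1.trans_lt hs', h1⟩
    rw [← ht]
    refine measureReal_mono fun ω hω => ?_
    by_contra hlt
    have h2 := monotone_margF P X j (not_le.1 hlt).le
    have h3 : margF P X j (X 0 ω j) ≤ s := hω
    linarith
  · rcases eq_or_lt_of_le hs.1 with rfl | hs0
    · exact measureReal_nonneg
    rcases eq_or_lt_of_le hs.2 with rfl | hs1
    · rw [show {ω | Uv P X 0 ω j ≤ 1} = univ from eq_univ_of_forall fun ω => (Uv_mem_Icc P X 0 ω j).2]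
      simp
    obtain ⟨t, ht⟩ := exists_margF_eq hmeas hcont ⟨hs0, hs1⟩
    rw [← ht]
    exact measureReal_mono fun ω hω => monotone_margF P X j hω

/-- The law of `U_0`. -/
def lawU (P : Measure Ω) (X : ℤ → Ω → Fin d → ℝ) : Measure (Fin d → ℝ) := P.map (Uv P X 0)

lemma measurable_Uv {P : Measure Ω} {X : ℤ → Ω → Fin d → ℝ} (hmeas : ∀ i, Measurable (X i))
    (hcont : ∀ j, Continuous (margF P X j)) (i : ℤ) : Measurable (Uv P X i) :=
  (measurable_margTransform hcont).comp (hmeas i)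

lemma cop_eq_lawU {P : Measure Ω} {X : ℤ → Ω → Fin d → ℝ} (hmeas : ∀ i, Measurable (X i))
    (hcont : ∀ j, Continuous (margF P X j)) (u : Fin d → ℝ) :
    cop P X u = (lawU P X).real (Iic u) := by
  rw [lawU, map_measureReal_apply (measurable_Uv hmeas hcont 0) measurableSet_Iic]
  rfl

lemma isProbabilityMeasure_lawU {P : Measure Ω} [IsProbabilityMeasure P]
    {X : ℤ → Ω → Fin d → ℝ} (hmeas : ∀ i, Measurable (X i))
    (hcont : ∀ j, Continuous (margF P X j)) : IsProbabilityMeasure (lawU P X) :=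
  Measure.isProbabilityMeasure_map (measurable_Uv hmeas hcont 0).aemeasurable

/-- A measure on `ℝ^d` has uniform marginals on `[0, 1]`. -/
def UniformMarginals (μ : Measure (Fin d → ℝ)) : Prop :=
  ∀ j, ∀ s ∈ Icc (0 : ℝ) 1, μ.real {x | x j ≤ s} = s

lemma uniformMarginals_lawU {P : Measure Ω} [IsProbabilityMeasure P]
    {X : ℤ → Ω → Fin d → ℝ} (hmeas : ∀ i, Measurable (X i))
    (hcont : ∀ j, Continuous (margF P X j)) : UniformMarginals (lawU P X) := fun j s hs => by
  rw [lawU, map_measureReal_apply (measurable_Uv hmeas hcont 0)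
    (measurableSet_le (measurable_pi_apply j) measurable_const)]
  exact measureReal_Uv_le (hmeas 0) (hcont j) hs

/-- The empirical measure of `U_1, …, U_n`. -/
def empLawU (P : Measure Ω) (X : ℤ → Ω → Fin d → ℝ) (n : ℕ) (ω : Ω) : Measure (Fin d → ℝ) :=
  (n : ℝ≥0∞)⁻¹ • ∑ i ∈ Finset.Icc (1 : ℤ) (n : ℤ), Measure.dirac (Uv P X i ω)

lemma isProbabilityMeasure_empLawU (P : Measure Ω) (X : ℤ → Ω → Fin d → ℝ) {n : ℕ} (hn : 1 ≤ n)
    (ω : Ω) : IsProbabilityMeasure (empLawU P X n ω) := by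
  constructor
  simp only [empLawU, Measure.smul_apply, Measure.finsetSum_apply, measure_univ, Finset.sum_const,
    Int.card_Icc, add_sub_cancel_right, Int.toNat_natCast, nsmul_eq_mul, mul_one, smul_eq_mul]
  exact ENNReal.inv_mul_cancel (by exact_mod_cast (by omega : n ≠ 0)) (by simp)

lemma empLawU_real_apply (P : Measure Ω) (X : ℤ → Ω → Fin d → ℝ) (n : ℕ) (ω : Ω)
    {B : Set (Fin d → ℝ)} (hB : MeasurableSet B) :
    (empLawU P X n ω).real B =
      (n : ℝ)⁻¹ * ∑ i ∈ Finset.Icc (1 : ℤ) (n : ℤ), indic B (Uv P X i ω) := by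
  simp only [empLawU, Measure.real, Measure.smul_apply, Measure.finsetSum_apply, smul_eq_mul,
    ENNReal.toReal_mul, ENNReal.toReal_inv, ENNReal.toReal_natCast]
  rw [ENNReal.toReal_sum fun i _ => measure_ne_top _ _]
  congr 2
  ext i
  rw [Measure.dirac_apply' _ hB, indic]
  by_cases h : Uv P X i ω ∈ B <;> simp [h]

lemma Gn_eq_empLawU (P : Measure Ω) (X : ℤ → Ω → Fin d → ℝ) (n : ℕ) (u : Fin d → ℝ) (ω : Ω) :
    Gn P X n u ω = (empLawU P X n ω).real (Iic u) := by
  rw [empLawU_real_apply _ _ _ _ measurableSet_Iic]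
  rfl

lemma UniformMarginals.measureReal_Ioc_le {μ : Measure (Fin d → ℝ)} [IsProbabilityMeasure μ]
    (hμ : UniformMarginals μ) (j : Fin d) {s t : ℝ} (hst : s ≤ t) (ht : t ≤ 1) :
    μ.real {x | s < x j ∧ x j ≤ t} ≤ t - s := by
  have hms : ∀ r, MeasurableSet {x : Fin d → ℝ | x j ≤ r} := fun r =>
    measurableSet_le (measurable_pi_apply j) measurable_const
  rcases lt_or_ge t 0 with h0 | h0
  · have h1 : μ.real {x | s < x j ∧ x j ≤ t} ≤ μ.real {x | x j ≤ 0} :=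
      measureReal_mono fun x hx => hx.2.trans h0.le
    rw [hμ j 0 (by simp)] at h1
    linarith
  rcases lt_or_ge s 0 with h1 | h1
  · have h2 : μ.real {x | s < x j ∧ x j ≤ t} ≤ μ.real {x | x j ≤ t} :=
      measureReal_mono fun x hx => hx.2
    rw [hμ j t ⟨h0, ht⟩] at h2
    linarith
  · have e : {x : Fin d → ℝ | s < x j ∧ x j ≤ t} = {x | x j ≤ t} \ {x | x j ≤ s} := by
      ext x; simp [and_comm]
    rw [e, measureReal_sdiff (show {x : Fin d → ℝ | x j ≤ s} ⊆ {x | x j ≤ t} from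
      fun x hx => le_trans hx hst) (hms s), hμ j t ⟨h0, ht⟩,
      hμ j s ⟨h1, hst.trans ht⟩]

/-- The measure `ν` is close to `μ` on differences of orthants, with variance-dependent error. -/
def CloseOnOrthants (μ ν : Measure (Fin d → ℝ)) (A : ℝ) : Prop :=
  ∀ x y : Fin d → ℝ, (∀ j, x j ∈ Icc (-1 : ℝ) 1) → (∀ j, y j ∈ Icc (-1 : ℝ) 1) →
    |ν.real (Iic y \ Iic x) - μ.real (Iic y \ Iic x)| ≤ A * √(μ.real (Iic y \ Iic x)) + A ^ 2

lemma measurableSet_Iic_diff (x y : Fin d → ℝ) : MeasurableSet (Iic y \ Iic x) :=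
  measurableSet_Iic.diff measurableSet_Iic

/-- The measure of an enlarged difference of orthants. -/
lemma measureReal_orthant_diff_le {μ : Measure (Fin d → ℝ)} [IsProbabilityMeasure μ]
    (hμ : UniformMarginals μ) {x x' y y' : Fin d → ℝ} {r : ℝ} (hx : x ≤ x') (hy : y ≤ y')
    (hx1 : ∀ j, x' j ≤ 1) (hy1 : ∀ j, y' j ≤ 1) (hxr : ∀ j, x' j - x j ≤ r)
    (hyr : ∀ j, y' j - y j ≤ r) :
    μ.real (Iic y' \ Iic x) ≤ μ.real (Iic y \ Iic x') + d * (2 * r) := by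
  have hsub : Iic y' \ Iic x ⊆ (Iic y \ Iic x') ∪
      ⋃ j ∈ (Finset.univ : Finset (Fin d)),
        ({z | x j < z j ∧ z j ≤ x' j} ∪ {z | y j < z j ∧ z j ≤ y' j}) := by
    intro z hz
    by_cases h : z ∈ Iic y \ Iic x'
    · exact Or.inl h
    · right
      simp only [Set.mem_sdiff, mem_Iic, not_and, not_not] at h hz
      simp only [Finset.mem_univ, iUnion_true, mem_iUnion]
      by_cases hzy : z ≤ y
      · have h2 := h hzy
        obtain ⟨j, hj⟩ := not_forall.1 hz.2
        exact ⟨j, Or.inl ⟨not_le.1 hj, h2 j⟩⟩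
      · obtain ⟨j, hj⟩ := not_forall.1 hzy
        exact ⟨j, Or.inr ⟨not_le.1 hj, hz.1 j⟩⟩
  refine (measureReal_mono hsub).trans ((measureReal_union_le _ _).trans ?_)
  gcongr
  refine (measureReal_biUnion_finset_le _ _).trans ?_
  calc _ ≤ ∑ j : Fin d, 2 * r := Finset.sum_le_sum fun j _ => ?_
    _ = _ := by simp
  refine (measureReal_union_le _ _).trans ?_
  have h1 := hμ.measureReal_Ioc_le j (hx j) (hx1 j)
  have h2 := hμ.measureReal_Ioc_le j (hy j) (hy1 j)
  linarith [hxr j, hyr j]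

/-- Closeness on the grid with mesh `1 / n` implies closeness everywhere. -/
lemma closeOnOrthants_of_grid {μ ν : Measure (Fin d → ℝ)} [IsProbabilityMeasure μ]
    [IsProbabilityMeasure ν] (hμ : UniformMarginals μ) (hd : 1 ≤ d) {n : ℕ} (hn : 1 ≤ n) {s : ℝ}
    (hs : 0 ≤ s)
    (h : ∀ a b : Fin d → ℤ, (∀ j, a j ∈ Finset.Icc (-(n : ℤ)) n) →
      (∀ j, b j ∈ Finset.Icc (-(n : ℤ)) n) →
      |ν.real (Iic (fun j => (b j : ℝ) / n) \ Iic (fun j => (a j : ℝ) / n)) -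
        μ.real (Iic (fun j => (b j : ℝ) / n) \ Iic (fun j => (a j : ℝ) / n))| ≤
      (n : ℝ) ^ (s - 1) *
        max 1 √(n * μ.real (Iic (fun j => (b j : ℝ) / n) \ Iic (fun j => (a j : ℝ) / n)))) :
    CloseOnOrthants μ ν ((1 + 2 * d) * (n : ℝ) ^ (s - 1 / 2)) := by
  intro x y hx hy
  have hn0 : (0 : ℝ) < n := by exact_mod_cast hn
  have hn1 : (1 : ℝ) ≤ n := by exact_mod_cast hn
  have hfl : ∀ t ∈ Icc (-1 : ℝ) 1, ⌊n * t⌋ ∈ Finset.Icc (-(n : ℤ)) n ∧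
      ⌈n * t⌉ ∈ Finset.Icc (-(n : ℤ)) n := by
    intro t ht
    have h1 : -(n : ℝ) ≤ n * t := by nlinarith [ht.1]
    have h2 : n * t ≤ n := by nlinarith [ht.2]
    have e1 : -(n : ℤ) ≤ ⌊n * t⌋ := Int.le_floor.2 (by push_cast; exact h1)
    have e2 : ⌈n * t⌉ ≤ (n : ℤ) := Int.ceil_le.2 (by push_cast; exact h2)
    have e3 := Int.floor_le_ceil (n * t)
    simp only [Finset.mem_Icc]
    omega
  have hfloor : ∀ t : ℝ, (⌊n * t⌋ : ℝ) / n ≤ t := fun t => by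
    rw [div_le_iff₀ hn0]; linarith [Int.floor_le (n * t)]
  have hceil : ∀ t : ℝ, t ≤ (⌈n * t⌉ : ℝ) / n := fun t => by
    rw [le_div_iff₀ hn0]; linarith [Int.le_ceil (n * t)]
  have hgap : ∀ t : ℝ, (⌈n * t⌉ : ℝ) / n - (⌊n * t⌋ : ℝ) / n ≤ 1 / n := fun t => by
    rw [← sub_div]
    gcongr
    have : ⌈n * t⌉ ≤ ⌊n * t⌋ + 1 := Int.ceil_le_floor_add_one _
    have : (⌈n * t⌉ : ℝ) ≤ ⌊n * t⌋ + 1 := by exact_mod_cast this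
    linarith
  have hceil1 : ∀ t ∈ Icc (-1 : ℝ) 1, (⌈n * t⌉ : ℝ) / n ≤ 1 := fun t ht => by
    rw [div_le_one hn0]
    exact_mod_cast (Finset.mem_Icc.1 (hfl t ht).2).2
  set S := Iic y \ Iic x
  set I := Iic (fun j => (⌊n * y j⌋ : ℝ) / n) \ Iic (fun j => (⌈n * x j⌉ : ℝ) / n)
  set O := Iic (fun j => (⌈n * y j⌉ : ℝ) / n) \ Iic (fun j => (⌊n * x j⌋ : ℝ) / n)
  have hIS : I ⊆ S := sdiff_subset_sdiff (Iic_subset_Iic.2 fun j => hfloor _)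
    (Iic_subset_Iic.2 fun j => hceil _)
  have hSO : S ⊆ O := sdiff_subset_sdiff (Iic_subset_Iic.2 fun j => hceil _)
    (Iic_subset_Iic.2 fun j => hfloor _)
  have hOI : μ.real O ≤ μ.real I + d * (2 * (1 / n)) :=
    measureReal_orthant_diff_le hμ (fun j => (hfloor _).trans (hceil _))
      (fun j => (hfloor _).trans (hceil _)) (fun j => hceil1 _ (hx j)) (fun j => hceil1 _ (hy j))
      (fun j => hgap _) (fun j => hgap _)
  have hI := h (fun j => ⌈n * x j⌉) (fun j => ⌊n * y j⌋) (fun j => (hfl _ (hx j)).2)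
    (fun j => (hfl _ (hy j)).1)
  have hO := h (fun j => ⌊n * x j⌋) (fun j => ⌈n * y j⌉) (fun j => (hfl _ (hx j)).1)
    (fun j => (hfl _ (hy j)).2)
  have m1 : μ.real I ≤ μ.real S := measureReal_mono hIS
  have m2 : μ.real S ≤ μ.real O := measureReal_mono hSO
  have m3 : ν.real I ≤ ν.real S := measureReal_mono hIS
  have m4 : ν.real S ≤ ν.real O := measureReal_mono hSO
  have hp0 : 0 ≤ μ.real S := measureReal_nonneg
  have hd1 : (1 : ℝ) ≤ d := by exact_mod_cast hd
  have hroot : ∀ p, p ≤ μ.real S + d * (2 * (1 / n)) →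
      (n : ℝ) ^ (s - 1) * max 1 √(n * p) ≤
        (n : ℝ) ^ (s - 1 / 2) * √(μ.real S) + (n : ℝ) ^ (s - 1) * (1 + 2 * d) := by
    intro p hp
    have h1 : √(n * p) ≤ √n * √(μ.real S) + 2 * d := by
      have e : n * p ≤ n * μ.real S + 2 * d := by
        calc n * p ≤ n * (μ.real S + d * (2 * (1 / n))) := by gcongr
          _ = _ := by field_simp
      rw [← Real.sqrt_mul hn0.le]
      refine Real.sqrt_le_iff.2 ⟨by positivity, e.trans ?_⟩
      rw [add_sq, Real.sq_sqrt (by positivity)]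
      have : 0 ≤ √(n * μ.real S) := Real.sqrt_nonneg _
      nlinarith
    have h2 : max 1 √(n * p) ≤ √n * √(μ.real S) + (1 + 2 * d) :=
      max_le (by have : 0 ≤ √n * √(μ.real S) := by positivity
                 linarith) (by linarith)
    have h3 : (n : ℝ) ^ (s - 1 / 2) = (n : ℝ) ^ (s - 1) * √n := by
      rw [Real.sqrt_eq_rpow, ← Real.rpow_add hn0]; congr 1; ring
    calc _ ≤ (n : ℝ) ^ (s - 1) * (√n * √(μ.real S) + (1 + 2 * d)) := by gcongr
      _ = _ := by rw [h3]; ring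
  have r1 := hroot _ (m1.trans (by have : 0 ≤ (d : ℝ) * (2 * (1 / n)) := by positivity
                                   linarith))
  have r2 := hroot _ (hOI.trans (by gcongr))
  have hn' : 1 / (n : ℝ) ≤ (n : ℝ) ^ (s - 1) := by
    rw [one_div, ← Real.rpow_neg_one]
    exact Real.rpow_le_rpow_of_exponent_le hn1 (by linarith)
  have hA2 : (n : ℝ) ^ (s - 1) ≤ ((n : ℝ) ^ (s - 1 / 2)) ^ 2 := by
    rw [← Real.rpow_natCast, ← Real.rpow_mul hn0.le]
    exact Real.rpow_le_rpow_of_exponent_le hn1 (by push_cast; linarith)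
  have hfin : (n : ℝ) ^ (s - 1) * (1 + 2 * d) + d * (2 * (1 / n)) ≤
      ((1 + 2 * d) * (n : ℝ) ^ (s - 1 / 2)) ^ 2 := by
    calc _ ≤ (n : ℝ) ^ (s - 1) * (1 + 2 * d) + d * (2 * (n : ℝ) ^ (s - 1)) := by gcongr
      _ = (1 + 4 * d) * (n : ℝ) ^ (s - 1) := by ring
      _ ≤ (1 + 2 * d) ^ 2 * ((n : ℝ) ^ (s - 1 / 2)) ^ 2 := by
          gcongr; nlinarith
      _ = _ := by ring
  have hmain : (n : ℝ) ^ (s - 1 / 2) * √(μ.real S) ≤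
      (1 + 2 * d) * (n : ℝ) ^ (s - 1 / 2) * √(μ.real S) := by
    have : 0 ≤ (n : ℝ) ^ (s - 1 / 2) * √(μ.real S) := by positivity
    nlinarith
  have a1 := abs_le.1 hI
  have a2 := abs_le.1 hO
  change -_ ≤ ν.real I - μ.real I ∧ ν.real I - μ.real I ≤ _ at a1
  change -_ ≤ ν.real O - μ.real O ∧ ν.real O - μ.real O ≤ _ at a2
  exact abs_le.2 ⟨by linarith [a1.1], by linarith [a2.2]⟩

/-- Under exponential mixing, the empirical law is close to the law of `U_0` on all differences of
orthants, with probability tending to one. -/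
lemma tendsto_not_closeOnOrthants {P : Measure Ω} [IsProbabilityMeasure P]
    {X : ℤ → Ω → Fin d → ℝ} (hd : 1 ≤ d) (hmeas : ∀ i, Measurable (X i))
    (hstat : StrictlyStationary P X) (hcont : ∀ j, Continuous (margF P X j))
    (hmix : ExpAlphaMixing P X) {s : ℝ} (hs : 0 < s) :
    Tendsto (fun n : ℕ => P {ω | ¬ CloseOnOrthants (lawU P X) (empLawU P X n ω)
      ((1 + 2 * d) * (n : ℝ) ^ (s - 1 / 2))}) atTop (nhds 0) := by
  have hμ := uniformMarginals_lawU (P := P) hmeas hcont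
  have hpr := isProbabilityMeasure_lawU (P := P) hmeas hcont
  obtain ⟨C, hC⟩ := exists_tail_emp_le P hmeas hmix hs (2 * d + 1)
  have hlim : Tendsto (fun n : ℕ => ENNReal.ofReal (3 ^ (2 * d) * |C| * (1 / n)))
      atTop (nhds 0) := by
    have h1 := (tendsto_one_div_atTop_nhds_zero_nat (𝕜 := ℝ)).const_mul (3 ^ (2 * d) * |C|)
    have h2 := ENNReal.tendsto_ofReal h1
    simpa using h2
  refine tendsto_of_tendsto_of_tendsto_of_le_of_le' tendsto_const_nhds hlim
    (Eventually.of_forall fun _ => zero_le) ?_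
  filter_upwards [hC, eventually_ge_atTop 1] with n hCn hn
  have hn0 : (0 : ℝ) < n := by exact_mod_cast hn
  have hn1 : (1 : ℝ) ≤ n := by exact_mod_cast hn
  set grid : Finset (Fin d → ℤ) := Fintype.piFinset fun _ => Finset.Icc (-(n : ℤ)) n with hgrid
  set R : (Fin d → ℤ) × (Fin d → ℤ) → Set (Fin d → ℝ) := fun p =>
    Iic (fun j => (p.2 j : ℝ) / n) \ Iic (fun j => (p.1 j : ℝ) / n) with hR
  set bad : (Fin d → ℤ) × (Fin d → ℤ) → Set Ω := fun p =>
    {ω | (n : ℝ) ^ (s - 1) * max 1 √(n * (lawU P X).real (R p)) <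
      |(empLawU P X n ω).real (R p) - (lawU P X).real (R p)|} with hbad
  have hsub : {ω | ¬ CloseOnOrthants (lawU P X) (empLawU P X n ω)
      ((1 + 2 * d) * (n : ℝ) ^ (s - 1 / 2))} ⊆ ⋃ p ∈ grid ×ˢ grid, bad p := by
    intro ω hω
    by_contra hnot
    apply hω
    have := isProbabilityMeasure_empLawU P X hn ω
    refine closeOnOrthants_of_grid hμ hd hn hs.le fun a b ha hb => ?_
    by_contra hlt
    apply hnot
    simp only [mem_iUnion]
    exact ⟨(a, b), Finset.mem_product.2 ⟨Fintype.mem_piFinset.2 ha, Fintype.mem_piFinset.2 hb⟩,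
      not_le.1 hlt⟩
  have hbadle : ∀ p, P.real (bad p) ≤ |C| * (n : ℝ) ^ (-((2 * d + 1 : ℕ) : ℝ)) := by
    intro p
    have hRm : MeasurableSet (R p) := measurableSet_Iic_diff _ _
    have hB : MeasurableSet (margTransform P X ⁻¹' R p) := measurable_margTransform hcont hRm
    have hprob : ∀ i, P.real (X i ⁻¹' (margTransform P X ⁻¹' R p)) = (lawU P X).real (R p) := by
      intro i
      rw [measureReal_preimage_eq_of_stationary hmeas hstat hB i, lawU,
        map_measureReal_apply (measurable_Uv hmeas hcont 0) hRm]
      rfl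
    have := hCn _ hB _ hprob
    refine le_trans (le_of_eq ?_) (this.trans (by gcongr; exact le_abs_self C))
    simp only [hbad, empLawU_real_apply P X n _ hRm]
    rfl
  have hcard : ((grid ×ˢ grid).card : ℝ) ≤ (3 * n) ^ (2 * d) := by
    have e : grid.card = (2 * n + 1) ^ d := by
      rw [hgrid, Fintype.card_piFinset]
      simp only [Int.card_Icc, Finset.prod_const, Finset.card_univ, Fintype.card_fin]
      congr 1; omega
    rw [Finset.card_product, e]
    push_cast
    rw [← pow_add, ← two_mul]
    gcongr
    linarith
  have hreal : P.real {ω | ¬ CloseOnOrthants (lawU P X) (empLawU P X n ω)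
      ((1 + 2 * d) * (n : ℝ) ^ (s - 1 / 2))} ≤ 3 ^ (2 * d) * |C| * (1 / n) := by
    calc _ ≤ P.real (⋃ p ∈ grid ×ˢ grid, bad p) := measureReal_mono hsub (measure_ne_top _ _)
      _ ≤ ∑ p ∈ grid ×ˢ grid, P.real (bad p) := measureReal_biUnion_finset_le _ _
      _ ≤ (grid ×ˢ grid).card • (|C| * (n : ℝ) ^ (-((2 * d + 1 : ℕ) : ℝ))) :=
          Finset.sum_le_card_nsmul _ _ _ fun p _ => hbadle p
      _ ≤ (3 * n) ^ (2 * d) * (|C| * (n : ℝ) ^ (-((2 * d + 1 : ℕ) : ℝ))) := by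
          rw [nsmul_eq_mul]; gcongr
      _ = _ := by
          rw [Real.rpow_neg hn0.le, Real.rpow_natCast, mul_pow, pow_succ]
          field_simp
  rw [← ofReal_measureReal]
  exact ENNReal.ofReal_le_ofReal hreal

/-- The multivariate cumulative distribution function of a measure. -/
def mcdf (μ : Measure (Fin d → ℝ)) (u : Fin d → ℝ) : ℝ := μ.real (Iic u)

lemma mcdf_mono (μ : Measure (Fin d → ℝ)) [IsFiniteMeasure μ] : Monotone (mcdf μ) :=
  fun _ _ h => measureReal_mono (Iic_subset_Iic.2 h)

lemma measureReal_orthant_diff_le_sum {μ : Measure (Fin d → ℝ)} [IsProbabilityMeasure μ]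
    (hμ : UniformMarginals μ) {x y : Fin d → ℝ} (hy : ∀ j, y j ≤ 1) :
    μ.real (Iic y \ Iic x) ≤ ∑ j, max 0 (y j - x j) := by
  have hsub : Iic y \ Iic x ⊆ ⋃ j ∈ (Finset.univ : Finset (Fin d)), {z | x j < z j ∧ z j ≤ y j} := by
    intro z hz
    obtain ⟨j, hj⟩ := not_forall.1 hz.2
    simp only [Finset.mem_univ, iUnion_true, mem_iUnion]
    exact ⟨j, not_le.1 hj, hz.1 j⟩
  refine (measureReal_mono hsub (measure_ne_top _ _)).trans ((measureReal_biUnion_finset_le _ _).trans ?_)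
  refine Finset.sum_le_sum fun j _ => ?_
  rcases le_total (x j) (y j) with h | h
  · exact (hμ.measureReal_Ioc_le j h (hy j)).trans (le_max_right _ _)
  · refine le_trans (le_of_eq ?_) (le_max_left _ _)
    rw [show {z : Fin d → ℝ | x j < z j ∧ z j ≤ y j} = ∅ from
      eq_empty_of_forall_notMem fun z hz => (hz.1.trans_le (hz.2.trans h)).false, measureReal_empty]

lemma mcdf_le_apply {μ : Measure (Fin d → ℝ)} [IsProbabilityMeasure μ]
    (hμ : UniformMarginals μ) {u : Fin d → ℝ} {i : Fin d} (hu : u i ∈ Icc (0 : ℝ) 1) :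
    mcdf μ u ≤ u i :=
  (measureReal_mono fun _ (hx : _ ≤ u) => hx i).trans (hμ i _ hu).le

lemma mcdf_sub_le {μ : Measure (Fin d → ℝ)} [IsProbabilityMeasure μ] (x y : Fin d → ℝ) :
    mcdf μ y - mcdf μ x ≤ μ.real (Iic y \ Iic x) := by
  have h : Iic y ⊆ Iic x ∪ (Iic y \ Iic x) := fun z hz => by
    by_cases h : z ∈ Iic x
    · exact Or.inl h
    · exact Or.inr ⟨hz, h⟩
  have := (measureReal_mono (μ := μ) h).trans (measureReal_union_le _ _)
  simp only [mcdf]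
  linarith

lemma mcdf_update_sub_le {μ : Measure (Fin d → ℝ)} [IsProbabilityMeasure μ]
    (hμ : UniformMarginals μ) (u : Fin d → ℝ) (j : Fin d) {s t : ℝ} (hst : s ≤ t) (ht : t ≤ 1) :
    mcdf μ (Function.update u j t) - mcdf μ (Function.update u j s) ≤ t - s := by
  refine (mcdf_sub_le _ _).trans ?_
  refine le_trans (measureReal_mono fun z hz => ?_) (hμ.measureReal_Ioc_le j hst ht)
  have h1 : ∀ k, z k ≤ Function.update u j t k := hz.1
  refine ⟨not_le.1 fun h => hz.2 fun k => ?_, by simpa using h1 j⟩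
  rcases eq_or_ne k j with rfl | hk
  · simpa using h
  · simpa [hk] using h1 k

lemma mcdf_update_one {μ : Measure (Fin d → ℝ)} [IsProbabilityMeasure μ]
    (hμ : UniformMarginals μ) (j : Fin d) {s : ℝ} (hs : s ∈ Icc (0 : ℝ) 1) :
    mcdf μ (Function.update (fun _ => 1) j s) = s := by
  apply le_antisymm
  · refine (mcdf_le_apply hμ (i := j) (by simpa using hs)).trans (by simp)
  · have h1 : mcdf μ (fun _ => 1) = 1 := by
      have h0 : μ.real ((univ : Set (Fin d → ℝ)) \ Iic fun _ => 1) ≤ 0 := by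
        have hsub : (univ : Set (Fin d → ℝ)) \ Iic (fun _ => 1) ⊆
            ⋃ j ∈ (Finset.univ : Finset (Fin d)), {z | z j ≤ 1}ᶜ := by
          intro z hz
          obtain ⟨j, hj⟩ := not_forall.1 hz.2
          simp only [Finset.mem_univ, iUnion_true, mem_iUnion]
          exact ⟨j, hj⟩
        refine (measureReal_mono hsub (measure_ne_top _ _)).trans ((measureReal_biUnion_finset_le _ _).trans ?_)
        refine Finset.sum_nonpos fun j _ => ?_
        rw [probReal_compl_eq_one_sub (measurableSet_le (measurable_pi_apply j) measurable_const),
          hμ j 1 (by simp)]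
        simp
      rw [measureReal_sdiff (subset_univ _) measurableSet_Iic] at h0
      simp only [probReal_univ] at h0
      have : mcdf μ (fun _ => 1) ≤ 1 := measureReal_le_one
      simp only [mcdf] at this ⊢
      linarith
    have h2 := mcdf_update_sub_le hμ (fun _ => 1) j hs.2 le_rfl
    rw [Function.update_eq_self_iff.2 rfl, h1] at h2
    linarith

lemma mem_VV_update {w : Fin d → ℝ} (hw : ∀ k, w k ∈ Icc (0 : ℝ) 1) {j : Fin d} {t : ℝ}
    (ht : t ∈ Ioo (0 : ℝ) 1) : Function.update w j t ∈ VV d j := by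
  refine ⟨fun k => ?_, by simpa using ht⟩
  rcases eq_or_ne k j with rfl | hk
  · simpa using ⟨ht.1.le, ht.2.le⟩
  · simpa [hk] using hw k

section Copula

variable {μ : Measure (Fin d → ℝ)} [IsProbabilityMeasure μ]

lemma Cdot_nonneg (hC : Condition21 (mcdf μ)) {j : Fin d} {u : Fin d → ℝ} (hu : u ∈ VV d j) :
    0 ≤ Cdot (mcdf μ) j u := by
  rw [← (hC.1 j u hu).deriv]
  exact Monotone.deriv_nonneg fun s t hst => mcdf_mono μ (Function.update_mono hst)

lemma lipschitzOnWith_mcdf_update (hμ : UniformMarginals μ) (u : Fin d → ℝ) (j : Fin d) :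
    LipschitzOnWith 1 (fun t => mcdf μ (Function.update u j t)) (Iic 1) := by
  refine LipschitzOnWith.of_le_add_mul _ fun s hs t ht => ?_
  simp only [NNReal.coe_one, one_mul]
  rcases le_total s t with hst | hst
  · have := mcdf_mono μ (Function.update_mono hst : Function.update u j s ≤ Function.update u j t)
    linarith [dist_nonneg (x := s) (y := t)]
  · have h1 := mcdf_update_sub_le hμ u j hst hs
    rw [Real.dist_eq, abs_of_nonneg (by linarith)]
    linarith

lemma Cdot_le_one (hμ : UniformMarginals μ) (hC : Condition21 (mcdf μ)) {j : Fin d}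
    {u : Fin d → ℝ} (hu : u ∈ VV d j) : Cdot (mcdf μ) j u ≤ 1 := by
  have h := (hC.1 j u hu).le_of_lipschitzOn (Iic_mem_nhds hu.2.2) (lipschitzOnWith_mcdf_update hμ u j)
  exact (le_abs_self _).trans (by simpa using h)

lemma Cdot_eq_zero (hμ : UniformMarginals μ) (hC : Condition21 (mcdf μ)) {i j : Fin d}
    (hij : i ≠ j) {u : Fin d → ℝ} (hu : u ∈ VV d j) (h0 : u i = 0) : Cdot (mcdf μ) j u = 0 := by
  have h1 : (fun t => mcdf μ (Function.update u j t)) = fun _ => 0 := by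
    ext t
    refine le_antisymm ?_ measureReal_nonneg
    refine (mcdf_le_apply hμ (i := i) ?_).trans ?_ <;> simp [hij, h0]
  have h2 := hC.1 j u hu
  rw [h1] at h2
  exact h2.unique (hasDerivAt_const _ _)

lemma Cdot_eq_one (hμ : UniformMarginals μ) (hC : Condition21 (mcdf μ)) {i : Fin d} {s : ℝ}
    (hs : s ∈ Ioo (0 : ℝ) 1) : Cdot (mcdf μ) i (Function.update (fun _ => 1) i s) = 1 := by
  have h2 := hC.1 i _ (mem_VV_update (w := fun _ => 1) (fun _ => by simp) hs)
  simp only [Function.update_idem, Function.update_self] at h2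
  have h3 : HasDerivAt (fun t : ℝ => t) 1 s := hasDerivAt_id s
  refine h2.unique (h3.congr_of_eventuallyEq ?_)
  filter_upwards [Ioo_mem_nhds hs.1 hs.2] with t ht
  exact mcdf_update_one hμ i ⟨ht.1.le, ht.2.le⟩

end Copula

lemma min_mul_one_sub_le {a b t : ℝ} (ht : t ∈ uIcc a b) :
    min (a * (1 - a)) (b * (1 - b)) ≤ t * (1 - t) := by
  rcases le_total a b with h | h
  · rw [uIcc_of_le h] at ht
    rcases le_total (a + b) 1 with h1 | h1
    · exact (min_le_left _ _).trans (by nlinarith [ht.1, ht.2])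
    · exact (min_le_right _ _).trans (by nlinarith [ht.1, ht.2])
  · rw [uIcc_of_ge h] at ht
    rcases le_total (a + b) 1 with h1 | h1
    · exact (min_le_right _ _).trans (by nlinarith [ht.1, ht.2])
    · exact (min_le_left _ _).trans (by nlinarith [ht.1, ht.2])

/-- Mean value inequality in the form `|f b - f a| ≤ M |b - a|` on an unordered interval. -/
lemma abs_sub_le_of_hasDerivAt_uIoo {f f' : ℝ → ℝ} {a b M : ℝ} (hf : ContinuousOn f (uIcc a b))
    (hd : ∀ t ∈ uIoo a b, HasDerivAt f (f' t) t) (hM : ∀ t ∈ uIoo a b, |f' t| ≤ M) :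
    |f b - f a| ≤ M * |b - a| := by
  wlog h : a < b generalizing a b
  · rcases eq_or_lt_of_le (not_lt.1 h) with rfl | h'
    · simp
    · have := this (a := b) (b := a) (by rwa [uIcc_comm]) (by rwa [uIoo_comm]) (by rwa [uIoo_comm]) h'
      rwa [abs_sub_comm, abs_sub_comm b a]
  rw [uIcc_of_le h.le] at hf
  rw [uIoo_of_le h.le] at hd hM
  obtain ⟨c, hc, he⟩ := exists_hasDerivAt_eq_slope f f' h hf hd
  rw [eq_div_iff (sub_pos.2 h).ne'] at he
  rw [← he, abs_mul]
  exact mul_le_mul_of_nonneg_right (hM c hc) (abs_nonneg _)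

/-- A local Lipschitz estimate for the partial derivatives of a function satisfying
the second-order condition. -/
lemma exists_abs_Cdot_sub_le {C : (Fin d → ℝ) → ℝ} (hC : Condition21 C) :
    ∃ K : ℝ, 0 < K ∧ ∀ (j : Fin d) (x y : Fin d → ℝ), x ∈ VV d j → y ∈ VV d j →
      |Cdot C j y - Cdot C j x| ≤
        K * (∑ k, |y k - x k|) / min (x j * (1 - x j)) (y j * (1 - y j)) := by
  obtain ⟨-, hcont, Cdd, hder, -, K, hK, hbound⟩ := hC
  refine ⟨K, hK, fun j x y hx hy => ?_⟩
  set m := min (x j * (1 - x j)) (y j * (1 - y j)) with hm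
  have hm0 : 0 < m := lt_min (mul_pos hx.2.1 (by linarith [hx.2.2]))
    (mul_pos hy.2.1 (by linarith [hy.2.2]))
  have key : ∀ s : Finset (Fin d),
      |Cdot C j (s.piecewise y x) - Cdot C j x| ≤ K * (∑ k ∈ s, |y k - x k|) / m := by
    intro s
    induction s using Finset.induction_on with
    | empty => simp
    | insert k s hk ih =>
      set w := s.piecewise y x with hw
      have hwk : w k = x k := Finset.piecewise_eq_of_notMem _ _ _ hk
      have hwI : ∀ i, 0 ≤ w i ∧ w i ≤ 1 := fun i => by
        by_cases hi : i ∈ s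
        · rw [hw, Finset.piecewise_eq_of_mem _ _ _ hi]; exact hy.1 i
        · rw [hw, Finset.piecewise_eq_of_notMem _ _ _ hi]; exact hx.1 i
      have hwj : w j = x j ∨ w j = y j := by
        by_cases hi : j ∈ s
        · rw [hw, Finset.piecewise_eq_of_mem _ _ _ hi]; exact Or.inr rfl
        · rw [hw, Finset.piecewise_eq_of_notMem _ _ _ hi]; exact Or.inl rfl
      have hI : ∀ t ∈ uIcc (x k) (y k), 0 ≤ t ∧ t ≤ 1 := fun t ht => by
        have := uIcc_subset_Icc (hx.1 k) (hy.1 k) ht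
        exact this
      have hVj : ∀ t ∈ uIcc (x k) (y k), Function.update w k t ∈ VV d j ∧
          m ≤ Function.update w k t j * (1 - Function.update w k t j) := by
        intro t ht
        rcases eq_or_ne j k with rfl | hjk
        · have h1 := min_mul_one_sub_le ht
          have h2 := hI t ht
          have h3 : 0 < t * (1 - t) := hm0.trans_le h1
          refine ⟨mem_VV_update hwI ⟨?_, ?_⟩, by rw [Function.update_self]; exact h1⟩
          · by_contra hcon; nlinarith [h2.1]
          · by_contra hcon; nlinarith [h2.2]
        · have e : Function.update w k t j = w j := by simp [hjk]
          refine ⟨⟨fun i => ?_, ?_⟩, ?_⟩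
          · rcases eq_or_ne i k with rfl | hi
            · simpa using hI t ht
            · simpa [hi] using hwI i
          · rw [e]
            rcases hwj with h | h <;> rw [h]
            exacts [hx.2, hy.2]
          · rw [e]
            rcases hwj with h | h <;> rw [h]
            exacts [min_le_left _ _, min_le_right _ _]
      have hIoo : ∀ t ∈ uIoo (x k) (y k), Function.update w k t ∈ VV d k := fun t ht => by
        refine mem_VV_update hwI ?_
        rcases le_total (x k) (y k) with h | h
        · rw [uIoo_of_le h] at ht
          exact ⟨(hx.1 k).1.trans_lt ht.1, ht.2.trans_le (hy.1 k).2⟩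
        · rw [uIoo_of_ge h] at ht
          exact ⟨(hy.1 k).1.trans_lt ht.1, ht.2.trans_le (hx.1 k).2⟩
      have hmove : |Cdot C j (Function.update w k (y k)) - Cdot C j (Function.update w k (x k))| ≤
          K / m * |y k - x k| := by
        refine abs_sub_le_of_hasDerivAt_uIoo (f := fun t => Cdot C j (Function.update w k t))
          (f' := fun t => Cdd k j (Function.update w k t)) ?_ (fun t ht => ?_) fun t ht => ?_
        · have hu : Continuous fun t => Function.update w k t :=
            continuous_const.update k continuous_id
          exact (hcont j).comp hu.continuousOn fun t ht => (hVj t ht).1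
        · have h := hder k j (Function.update w k t)
            ⟨hIoo t ht, (hVj t (uIoo_subset_uIcc_self ht)).1⟩
          simpa using h
        · have hV := hVj t (uIoo_subset_uIcc_self ht)
          refine (hbound k j _ ⟨hIoo t ht, hV.1⟩).trans ?_
          rw [div_eq_mul_one_div K m]
          refine mul_le_mul_of_nonneg_left ?_ hK.le
          exact (min_le_right _ _).trans (one_div_le_one_div_of_le hm0 hV.2)
      rw [Finset.piecewise_insert, Finset.sum_insert hk]
      have e : Function.update w k (x k) = w := by rw [← hwk]; exact Function.update_eq_self _ _
      rw [e] at hmove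
      have h5 := abs_sub_le (Cdot C j (Function.update w k (y k))) (Cdot C j w) (Cdot C j x)
      have h6 : K * (|y k - x k| + ∑ k ∈ s, |y k - x k|) / m =
          K / m * |y k - x k| + K * (∑ k ∈ s, |y k - x k|) / m := by ring
      rw [h6]
      linarith
  have := key Finset.univ
  rwa [Finset.piecewise_univ] at this

section Deterministic

variable {μ ν : Measure (Fin d → ℝ)} [IsProbabilityMeasure μ] [IsProbabilityMeasure ν] {A : ℝ}

lemma abs_mcdf_sub_linear_le (hμ : UniformMarginals μ) (hC : Condition21 (mcdf μ))
    {u v τ : Fin d → ℝ} (hu : ∀ j, u j ∈ Ioo (0 : ℝ) 1) (hv : ∀ j, v j ∈ Icc (0 : ℝ) 1)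
    (hτ : ∀ j w, (∀ k, w k ∈ uIcc (u k) (v k)) → w j ∈ Ioo (0 : ℝ) 1 →
      |Cdot (mcdf μ) j w - Cdot (mcdf μ) j u| * |v j - u j| ≤ τ j) :
    |mcdf μ v - mcdf μ u - ∑ j, Cdot (mcdf μ) j u * (v j - u j)| ≤ ∑ j, τ j := by
  have key : ∀ s : Finset (Fin d), |mcdf μ (s.piecewise v u) - mcdf μ u -
      ∑ j ∈ s, Cdot (mcdf μ) j u * (v j - u j)| ≤ ∑ j ∈ s, τ j := by
    intro s
    induction s using Finset.induction_on with
    | empty => simp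
    | insert k s hk ih =>
      set w := s.piecewise v u with hw
      have hwk : w k = u k := Finset.piecewise_eq_of_notMem _ _ _ hk
      have hwI : ∀ i, w i ∈ uIcc (u i) (v i) := fun i => by
        by_cases hi : i ∈ s
        · rw [hw, Finset.piecewise_eq_of_mem _ _ _ hi]; exact right_mem_uIcc
        · rw [hw, Finset.piecewise_eq_of_notMem _ _ _ hi]; exact left_mem_uIcc
      have hsub : ∀ i, uIcc (u i) (v i) ⊆ Icc (0 : ℝ) 1 := fun i =>
        uIcc_subset_Icc ⟨(hu i).1.le, (hu i).2.le⟩ (hv i)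
      have hmove : |mcdf μ (Function.update w k (v k)) - mcdf μ w -
          Cdot (mcdf μ) k u * (v k - u k)| ≤ τ k := by
        rcases eq_or_ne (v k) (u k) with he | he
        · have h0 := hτ k u (fun _ => left_mem_uIcc) (hu k)
          rw [he, ← hwk, Function.update_eq_self]
          simpa using h0
        have hpos : 0 < |v k - u k| := abs_pos.2 (sub_ne_zero.2 he)
        have h := abs_sub_le_of_hasDerivAt_uIoo (a := u k) (b := v k) (M := τ k / |v k - u k|)
          (f := fun t => mcdf μ (Function.update w k t) - Cdot (mcdf μ) k u * t)
          (f' := fun t => Cdot (mcdf μ) k (Function.update w k t) - Cdot (mcdf μ) k u) ?_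
          (fun t ht => ?_) fun t ht => ?_
        · have e : Function.update w k (u k) = w := by rw [← hwk]; exact Function.update_eq_self _ _
          rw [e, div_mul_cancel₀ _ hpos.ne'] at h
          refine le_trans (le_of_eq ?_) h
          congr 1; ring
        · refine ContinuousOn.sub ?_ (by fun_prop)
          exact (lipschitzOnWith_mcdf_update hμ w k).continuousOn.mono fun t ht => (hsub k ht).2
        all_goals
          have hto : t ∈ Ioo (0 : ℝ) 1 := by
            rcases le_total (u k) (v k) with hle | hle
            · rw [uIoo_of_le hle] at ht
              exact ⟨(hu k).1.trans ht.1, ht.2.trans_le (hv k).2⟩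
            · rw [uIoo_of_ge hle] at ht
              exact ⟨(hv k).1.trans_lt ht.1, ht.2.trans (hu k).2⟩
        · have h := hC.1 k (Function.update w k t) (mem_VV_update (fun i => hsub i (hwI i)) hto)
          simp only [Function.update_idem, Function.update_self] at h
          have h' := h.sub ((hasDerivAt_id t).const_mul (Cdot (mcdf μ) k u))
          rw [mul_one] at h'
          exact h'
        · rw [le_div_iff₀ hpos]
          refine hτ k _ (fun i => ?_) (by simpa using hto)
          rcases eq_or_ne i k with rfl | hi
          · simpa using uIoo_subset_uIcc_self ht
          · simpa [hi] using hwI i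
      rw [Finset.piecewise_insert, Finset.sum_insert hk, Finset.sum_insert hk]
      have h5 := abs_add_le (mcdf μ (Function.update w k (v k)) - mcdf μ w -
          Cdot (mcdf μ) k u * (v k - u k)) (mcdf μ w - mcdf μ u -
      ∑ j ∈ s, Cdot (mcdf μ) j u * (v j - u j))
      refine le_trans (le_of_eq ?_) (h5.trans (add_le_add hmove ih))
      congr 1; ring
  have := key Finset.univ
  rwa [Finset.piecewise_univ] at this

lemma mcdf_sub_eq (μ : Measure (Fin d → ℝ)) [IsProbabilityMeasure μ] (x y : Fin d → ℝ) :
    mcdf μ y - mcdf μ x = μ.real (Iic y \ Iic x) - μ.real (Iic x \ Iic y) := by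
  have h1 := measureReal_inter_add_sdiff (μ := μ) (s := Iic y) (t := Iic x) measurableSet_Iic
  have h2 := measureReal_inter_add_sdiff (μ := μ) (s := Iic x) (t := Iic y) measurableSet_Iic
  rw [inter_comm] at h2
  simp only [mcdf]
  linarith

lemma CloseOnOrthants.abs_oscillation_le (hcl : CloseOnOrthants μ ν A) (hA : 0 ≤ A)
    {x y : Fin d → ℝ} (hx : ∀ j, x j ∈ Icc (0 : ℝ) 1) (hy : ∀ j, y j ∈ Icc (0 : ℝ) 1) {ρ : ℝ}
    (h1 : μ.real (Iic y \ Iic x) ≤ ρ) (h2 : μ.real (Iic x \ Iic y) ≤ ρ) :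
    |(mcdf ν y - mcdf μ y) - (mcdf ν x - mcdf μ x)| ≤ 2 * (A * √ρ) + 2 * A ^ 2 := by
  have hI : ∀ t ∈ Icc (0 : ℝ) 1, t ∈ Icc (-1 : ℝ) 1 := fun t ht => ⟨by linarith [ht.1], ht.2⟩
  have c1 := hcl x y (fun j => hI _ (hx j)) fun j => hI _ (hy j)
  have c2 := hcl y x (fun j => hI _ (hy j)) fun j => hI _ (hx j)
  have r1 : A * √(μ.real (Iic y \ Iic x)) ≤ A * √ρ := by gcongr
  have r2 : A * √(μ.real (Iic x \ Iic y)) ≤ A * √ρ := by gcongr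
  have e1 := mcdf_sub_eq μ x y
  have e2 := mcdf_sub_eq ν x y
  rw [abs_le] at c1 c2 ⊢
  constructor <;> linarith [c1.1, c1.2, c2.1, c2.2]

lemma CloseOnOrthants.abs_mcdf_update_one_sub_le (hμ : UniformMarginals μ)
    (hcl : CloseOnOrthants μ ν A) (hA : 0 ≤ A) (hν0 : ν.real (Iic fun _ => -1) = 0)
    (hν1 : ν.real (Iic fun _ => 1) = 1) (j : Fin d) {s : ℝ} (hs : s ∈ Icc (0 : ℝ) 1) :
    |mcdf ν (Function.update (fun _ => 1) j s) - s| ≤ 2 * (A * √(s * (1 - s))) + A ^ 2 := by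
  have hup : ∀ k, Function.update (fun _ : Fin d => (1 : ℝ)) j s k ∈ Icc (-1 : ℝ) 1 := fun k => by
    rcases eq_or_ne k j with rfl | hk
    · simpa using ⟨by linarith [hs.1], hs.2⟩
    · simp [hk]
  have hμs := mcdf_update_one hμ j hs
  have hμ1 : mcdf μ (fun _ => 1) = 1 := by
    have := mcdf_update_one hμ j (s := 1) (by simp)
    rwa [Function.update_eq_self_iff.2 rfl] at this
  have hμ0 : μ.real (Iic fun _ : Fin d => (-1 : ℝ)) = 0 := by
    refine le_antisymm (le_trans (measureReal_mono (s₂ := {x | x j ≤ 0}) fun x hx => ?_)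
      (hμ j 0 (by simp)).le) measureReal_nonneg
    exact le_trans (hx j) (by norm_num)
  have c1 := hcl (fun _ => -1) _ (fun _ => by norm_num) hup
  have c2 := hcl (Function.update (fun _ => 1) j s) (fun _ => 1) hup fun _ => by norm_num
  have hle : ∀ t : ℝ, t ≤ 1 → Function.update (fun _ : Fin d => (1 : ℝ)) j t ≤ fun _ => 1 :=
    fun t ht k => by
      rcases eq_or_ne k j with rfl | hk
      · simpa using ht
      · simp [hk]
  have hge : (fun _ => -1 : Fin d → ℝ) ≤ Function.update (fun _ => 1) j s := fun k => (hup k).1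
  rw [measureReal_sdiff (Iic_subset_Iic.2 hge) measurableSet_Iic, hν0,
    measureReal_sdiff (Iic_subset_Iic.2 hge) measurableSet_Iic, hμ0] at c1
  rw [measureReal_sdiff (Iic_subset_Iic.2 (hle s hs.2)) measurableSet_Iic, hν1,
    measureReal_sdiff (Iic_subset_Iic.2 (hle s hs.2)) measurableSet_Iic] at c2
  simp only [mcdf] at hμs hμ1 ⊢
  rw [hμs, sub_zero, sub_zero] at c1
  rw [hμs, hμ1] at c2
  rcases le_total s (1 / 2) with h | h
  · have : √s ≤ 2 * √(s * (1 - s)) := by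
      refine Real.sqrt_le_iff.2 ⟨by positivity, ?_⟩
      rw [mul_pow, Real.sq_sqrt (mul_nonneg hs.1 (by linarith [hs.2]))]
      nlinarith [hs.1]
    have := mul_le_mul_of_nonneg_left this hA
    exact c1.trans (by linarith)
  · have : √(1 - s) ≤ 2 * √(s * (1 - s)) := by
      refine Real.sqrt_le_iff.2 ⟨by positivity, ?_⟩
      rw [mul_pow, Real.sq_sqrt (mul_nonneg hs.1 (by linarith [hs.2]))]
      nlinarith [hs.2]
    have := mul_le_mul_of_nonneg_left this hA
    rw [abs_sub_comm] at c2
    refine le_trans (le_of_eq ?_) (c2.trans (by linarith))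
    congr 1; ring

lemma CloseOnOrthants.measureReal_hyperplane_le (hμ : UniformMarginals μ)
    (hcl : CloseOnOrthants μ ν A) (hA : A ∈ Ioc (0 : ℝ) 1)
    (hν1 : ν.real (Iic fun _ => 1) = 1) (j : Fin d) {s : ℝ} (hs : s ∈ Icc (0 : ℝ) 1) :
    ν.real {x | x j = s} ≤ 3 * A ^ 2 := by
  have hA2 : A ^ 2 ≤ 1 := pow_le_one₀ hA.1.le hA.2
  have hA2' : 0 < A ^ 2 := by have := hA.1; positivity
  have hup : ∀ t ∈ Icc (-1 : ℝ) 1, ∀ k,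
      Function.update (fun _ : Fin d => (1 : ℝ)) j t k ∈ Icc (-1 : ℝ) 1 := fun t ht k => by
    rcases eq_or_ne k j with rfl | hk
    · simpa using ht
    · simp [hk]
  set x := Function.update (fun _ : Fin d => (1 : ℝ)) j (s - A ^ 2) with hx
  set y := Function.update (fun _ : Fin d => (1 : ℝ)) j s with hy
  have c := hcl x y (hup _ ⟨by linarith [hs.1], by linarith [hs.2]⟩)
    (hup _ ⟨by linarith [hs.1], hs.2⟩)
  have hm : μ.real (Iic y \ Iic x) ≤ A ^ 2 := by
    refine le_trans (measureReal_mono fun z hz => ?_)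
      ((hμ.measureReal_Ioc_le j (s := s - A ^ 2) (t := s) (by linarith) hs.2).trans (by linarith))
    have h1 : ∀ k, z k ≤ y k := hz.1
    refine ⟨not_le.1 fun h => hz.2 fun k => ?_, by simpa [hy] using h1 j⟩
    rcases eq_or_ne k j with rfl | hk
    · simpa [hx] using h
    · simpa [hx, hy, hk] using h1 k
  have hsub : {z : Fin d → ℝ | z j = s} ⊆ (Iic y \ Iic x) ∪ (Iic fun _ => 1)ᶜ := by
    intro z hz
    by_cases h1 : z ∈ Iic fun _ : Fin d => (1 : ℝ)
    · refine Or.inl ⟨fun k => ?_, fun h => ?_⟩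
      · rcases eq_or_ne k j with rfl | hk
        · simpa [hy] using (show z k = s from hz).le
        · simpa [hy, hk] using h1 k
      · have h2 := h j
        simp only [hx, Function.update_self] at h2
        have h3 : z j = s := hz
        linarith
    · exact Or.inr h1
  have h0 : ν.real (Iic fun _ : Fin d => (1 : ℝ))ᶜ = 0 := by
    rw [probReal_compl_eq_one_sub measurableSet_Iic, hν1, sub_self]
  have h3 := (measureReal_mono (μ := ν) hsub).trans (measureReal_union_le _ _)
  have h4 : A * √(μ.real (Iic y \ Iic x)) ≤ A * A := by
    refine mul_le_mul_of_nonneg_left (Real.sqrt_le_iff.2 ⟨hA.1.le, hm⟩) hA.1.le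
  have := (abs_le.1 c).2
  nlinarith

lemma sqrt_add_le {a b : ℝ} (ha : 0 ≤ a) (hb : 0 ≤ b) : √(a + b) ≤ √a + √b := by
  refine Real.sqrt_le_iff.2 ⟨by positivity, ?_⟩
  rw [add_sq, Real.sq_sqrt ha, Real.sq_sqrt hb]
  have : 0 ≤ √a * √b := by positivity
  linarith

/-- Comparison of a quantile with its level. -/
lemma CloseOnOrthants.abs_quantile_sub_le (hμ : UniformMarginals μ)
    (hcl : CloseOnOrthants μ ν A) (hA : 0 ≤ A) (hν0 : ν.real (Iic fun _ => -1) = 0)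
    (hν1 : ν.real (Iic fun _ => 1) = 1) (j : Fin d) {a b : ℝ} (ha : a ∈ Icc (0 : ℝ) 1)
    (hb : b ∈ Icc (0 : ℝ) 1)
    (h : |mcdf ν (Function.update (fun _ => 1) j b) - a| ≤ 3 * A ^ 2) :
    |b - a| ≤ 12 * (A * √(a * (1 - a)) + A ^ 2) ∧ |b - a| ≤ 12 * (A * √(b * (1 - b)) + A ^ 2) := by
  have h1 := hcl.abs_mcdf_update_one_sub_le hμ hA hν0 hν1 j hb
  have hha : 0 ≤ a * (1 - a) := mul_nonneg ha.1 (by linarith [ha.2])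
  have hhb : 0 ≤ b * (1 - b) := mul_nonneg hb.1 (by linarith [hb.2])
  have h2 : |b - a| ≤ 2 * (A * √(b * (1 - b))) + 4 * A ^ 2 := by
    rw [abs_le] at *
    constructor <;> linarith [h1.1, h1.2, h.1, h.2]
  have hb0 : 0 ≤ A * √(b * (1 - b)) := by positivity
  have hA2 : 0 ≤ A ^ 2 := by positivity
  refine ⟨?_, by linarith⟩
  set δ := |b - a| with hδ
  have hδ0 : 0 ≤ δ := abs_nonneg _
  have h3 : √(b * (1 - b)) ≤ √(a * (1 - a)) + √δ := by
    have h4 : b * (1 - b) ≤ a * (1 - a) + δ := by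
      have e : b * (1 - b) - a * (1 - a) = (b - a) * (1 - a - b) := by ring
      have h5 : (b - a) * (1 - a - b) ≤ δ * 1 := by
        refine (le_abs_self _).trans ?_
        rw [abs_mul]
        refine mul_le_mul_of_nonneg_left (abs_le.2 ⟨?_, ?_⟩) hδ0 <;>
          linarith [ha.1, ha.2, hb.1, hb.2]
      linarith
    exact (Real.sqrt_le_sqrt h4).trans (sqrt_add_le hha hδ0)
  have h4 : 2 * (A * √δ) ≤ δ / 2 + 2 * A ^ 2 := by
    have h6 := Real.sq_sqrt hδ0
    nlinarith [sq_nonneg (√δ - 2 * A)]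
  have h5 : 2 * (A * √(b * (1 - b))) ≤ 2 * (A * √(a * (1 - a))) + 2 * (A * √δ) := by
    have := mul_le_mul_of_nonneg_left h3 hA
    linarith
  have ha0 : 0 ≤ A * √(a * (1 - a)) := by positivity
  linarith

lemma mul_le_of_le_sqrt {A x y m κ c : ℝ} (hA : 0 ≤ A) (hc : 0 ≤ c) (hx0 : 0 ≤ x) (hx1 : x ≤ 1)
    (hm : 0 ≤ m) (hy : y ≤ c * (A * √m + A ^ 2)) (hxm : x * m ≤ κ) :
    x * y ≤ c * (A * √κ + A ^ 2) := by
  have h1 : x * √m ≤ √κ := by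
    refine Real.le_sqrt_of_sq_le ?_
    rw [mul_pow, Real.sq_sqrt hm]
    nlinarith [mul_nonneg hx0 hm]
  calc x * y ≤ x * (c * (A * √m + A ^ 2)) := by gcongr
    _ = c * (A * (x * √m) + x * A ^ 2) := by ring
    _ ≤ c * (A * √κ + 1 * A ^ 2) := by gcongr
    _ = _ := by ring

end Deterministic

section Remainder

variable {μ ν : Measure (Fin d → ℝ)} [IsProbabilityMeasure μ] [IsProbabilityMeasure ν] {A K : ℝ}

/-- The Lipschitz-type estimate for the partial derivatives of `C` with constant `K`. -/
def CdotLip (C : (Fin d → ℝ) → ℝ) (K : ℝ) : Prop :=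
  ∀ (j : Fin d) (x y : Fin d → ℝ), x ∈ VV d j → y ∈ VV d j → |Cdot C j y - Cdot C j x| ≤
    K * (∑ k, |y k - x k|) / min (x j * (1 - x j)) (y j * (1 - y j))

lemma mul_one_sub_pos {w : Fin d → ℝ} {j : Fin d} (hw : w ∈ VV d j) : 0 < w j * (1 - w j) :=
  mul_pos hw.2.1 (by linarith [hw.2.2])

lemma Cdot_mul_le (hμ : UniformMarginals μ) (hC : Condition21 (mcdf μ)) (hL : CdotLip (mcdf μ) K)
    {i j : Fin d} (hij : i ≠ j) {w : Fin d → ℝ} (hw : w ∈ VV d j) :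
    Cdot (mcdf μ) j w * (w j * (1 - w j)) ≤ K * w i := by
  have hw0 : Function.update w i 0 ∈ VV d j := by
    refine ⟨fun k => ?_, by simpa [hij.symm] using hw.2⟩
    rcases eq_or_ne k i with rfl | hk
    · simp
    · simpa [hk] using hw.1 k
  have h := hL j _ _ hw0 hw
  have hs : ∑ k, |w k - Function.update w i 0 k| = w i := by
    rw [Finset.sum_eq_single i]
    · simpa using (hw.1 i).1
    · intro k _ hk; simp [hk]
    · simp
  rw [Cdot_eq_zero hμ hC hij hw0 (by simp), hs, sub_zero, Function.update_of_ne hij.symm, min_self,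
    le_div_iff₀ (mul_one_sub_pos hw)] at h
  exact (mul_le_mul_of_nonneg_right (le_abs_self _) (mul_one_sub_pos hw).le).trans h

lemma one_sub_Cdot_mul_le (hμ : UniformMarginals μ) (hC : Condition21 (mcdf μ))
    (hL : CdotLip (mcdf μ) K) (hK : 0 ≤ K) {i : Fin d} {w : Fin d → ℝ} (hw : w ∈ VV d i) {r : ℝ}
    (hr0 : 0 ≤ r) (hr : ∀ k, k ≠ i → 1 - w k ≤ r) :
    (1 - Cdot (mcdf μ) i w) * (w i * (1 - w i)) ≤ K * (d * r) := by
  have hw1 := mem_VV_update (w := fun _ => 1) (j := i) (fun _ => by simp) hw.2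
  have h := hL i _ _ hw hw1
  have hs : ∑ k, |Function.update (fun _ => (1 : ℝ)) i (w i) k - w k| ≤ d * r := by
    calc _ ≤ ∑ _k : Fin d, r := Finset.sum_le_sum fun k _ => ?_
      _ = _ := by simp
    rcases eq_or_ne k i with rfl | hk
    · simpa using hr0
    · rw [Function.update_of_ne hk, abs_of_nonneg (by linarith [(hw.1 k).2])]
      exact hr k hk
  rw [Cdot_eq_one hμ hC hw.2, Function.update_self, min_self, le_div_iff₀ (mul_one_sub_pos hw)] at h
  exact ((mul_le_mul_of_nonneg_right (le_abs_self _) (mul_one_sub_pos hw).le).trans h).trans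
    (by gcongr)

/-- The contribution of one coordinate to the linearization error. -/
lemma abs_Cdot_sub_mul_le (hμ : UniformMarginals μ) (hC : Condition21 (mcdf μ)) (hA : 0 ≤ A)
    {j : Fin d} {u v w : Fin d → ℝ} {κ : ℝ} (hu : u ∈ VV d j) (hw : w ∈ VV d j)
    (hwj : w j ∈ uIcc (u j) (v j))
    (h1 : |v j - u j| ≤ 12 * (A * √(u j * (1 - u j)) + A ^ 2))
    (h2 : |v j - u j| ≤ 12 * (A * √(v j * (1 - v j)) + A ^ 2))
    (hκ : |Cdot (mcdf μ) j w - Cdot (mcdf μ) j u| * min (u j * (1 - u j)) (w j * (1 - w j)) ≤ κ) :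
    |Cdot (mcdf μ) j w - Cdot (mcdf μ) j u| * |v j - u j| ≤ 12 * (A * √κ + A ^ 2) := by
  have hm : min (u j * (1 - u j)) (v j * (1 - v j)) ≤ min (u j * (1 - u j)) (w j * (1 - w j)) :=
    le_min (min_le_left _ _) (min_mul_one_sub_le hwj)
  refine mul_le_of_le_sqrt hA (by norm_num) (abs_nonneg _) ?_ ?_ ?_ hκ
  · have a1 := Cdot_nonneg hC hu
    have a2 := Cdot_nonneg hC hw
    have a3 := Cdot_le_one hμ hC hu
    have a4 := Cdot_le_one hμ hC hw
    rw [abs_le]; constructor <;> linarith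
  · exact le_min (mul_one_sub_pos hu).le (mul_one_sub_pos hw).le
  · have h3 : |v j - u j| ≤ 12 * (A * √(min (u j * (1 - u j)) (v j * (1 - v j))) + A ^ 2) := by
      rcases min_choice (u j * (1 - u j)) (v j * (1 - v j)) with h | h <;> rw [h] <;> assumption
    exact h3.trans (by gcongr)

lemma abs_sub_le_max_of_nonneg {x y : ℝ} (hx : 0 ≤ x) (hy : 0 ≤ y) : |x - y| ≤ max x y := by
  rw [abs_le]
  constructor <;> linarith [le_max_left x y, le_max_right x y]

lemma mul_sqrt_mul_le {A c g : ℝ} (hA : 0 ≤ A) (hc : 0 ≤ c) (hg : 0 ≤ g) :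
    A * √(c * (g + A ^ 2)) ≤ √c * (A * √g + A ^ 2) := by
  have h := sqrt_add_le hg (sq_nonneg A)
  rw [Real.sqrt_sq hA] at h
  rw [Real.sqrt_mul hc]
  calc A * (√c * √(g + A ^ 2)) ≤ A * (√c * (√g + A)) := by gcongr
    _ = _ := by ring

/-- Error of the linear approximation to the empirical copula at `u`. -/
def copulaRemainder (μ ν : Measure (Fin d → ℝ)) (Chat : ℝ) (u : Fin d → ℝ) : ℝ :=
  (Chat - mcdf μ u) - ((mcdf ν u - mcdf μ u) -
    ∑ j, Cdot (mcdf μ) j u * (mcdf ν (Function.update (fun _ => 1) j (u j)) - u j))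

/-- Linearized error in the `j`-th coordinate. -/
def coordError (ν : Measure (Fin d → ℝ)) (u v : Fin d → ℝ) (j : Fin d) : ℝ :=
  v j - u j + (mcdf ν (Function.update (fun _ => 1) j (u j)) - u j)

lemma abs_copulaRemainder_le (μ ν : Measure (Fin d → ℝ)) (Chat : ℝ) (u v : Fin d → ℝ) :
    |copulaRemainder μ ν Chat u| ≤ |Chat - mcdf ν v| +
      |((mcdf ν v - mcdf μ v) - (mcdf ν u - mcdf μ u)) +
        ∑ j, Cdot (mcdf μ) j u * coordError ν u v j| +
      |mcdf μ v - mcdf μ u - ∑ j, Cdot (mcdf μ) j u * (v j - u j)| := by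
  refine le_trans (le_of_eq ?_) (abs_add_three _ _ _)
  simp only [copulaRemainder, coordError, mul_add, Finset.sum_add_distrib]
  congr 1; ring

section Bounds

variable {u v : Fin d → ℝ}

lemma mem_VV_of_Ioo (hu : ∀ j, u j ∈ Ioo (0 : ℝ) 1) (j : Fin d) : u ∈ VV d j :=
  ⟨fun k => ⟨(hu k).1.le, (hu k).2.le⟩, hu j⟩

lemma abs_coordError_le (hμ : UniformMarginals μ) (hcl : CloseOnOrthants μ ν A) (hA : 0 ≤ A)
    (hν0 : ν.real (Iic fun _ => -1) = 0) (hν1 : ν.real (Iic fun _ => 1) = 1) {j : Fin d}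
    (hu : u j ∈ Icc (0 : ℝ) 1) (h1 : |v j - u j| ≤ 12 * (A * √(u j * (1 - u j)) + A ^ 2)) :
    |coordError ν u v j| ≤ 14 * (A * √(u j * (1 - u j)) + A ^ 2) := by
  have h2 := hcl.abs_mcdf_update_one_sub_le hμ hA hν0 hν1 j hu
  have h3 : 0 ≤ A ^ 2 := by positivity
  exact (abs_add_le _ _).trans (by linarith)

lemma coordError_eq (hμ : UniformMarginals μ) {j : Fin d}
    (hu : u j ∈ Icc (0 : ℝ) 1) (hv : v j ∈ Icc (0 : ℝ) 1) :
    coordError ν u v j = (mcdf ν (Function.update (fun _ => 1) j (v j)) - u j) -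
      ((mcdf ν (Function.update (fun _ => 1) j (v j)) -
        mcdf μ (Function.update (fun _ => 1) j (v j))) -
      (mcdf ν (Function.update (fun _ => 1) j (u j)) -
        mcdf μ (Function.update (fun _ => 1) j (u j)))) := by
  rw [mcdf_update_one hμ j hu, mcdf_update_one hμ j hv, coordError]
  ring

/-- Remainder bound in the bulk. -/
lemma abs_copulaRemainder_le_bulk (hμ : UniformMarginals μ) (hC : Condition21 (mcdf μ))
    (hL : CdotLip (mcdf μ) K) (hK : 0 ≤ K) (hcl : CloseOnOrthants μ ν A) (hA : A ∈ Ioc (0 : ℝ) 1)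
    (hν0 : ν.real (Iic fun _ => -1) = 0) (hν1 : ν.real (Iic fun _ => 1) = 1)
    (hu : ∀ j, u j ∈ Ioo (0 : ℝ) 1) (hv : ∀ j, v j ∈ Icc (0 : ℝ) 1)
    (hvq : ∀ j, |mcdf ν (Function.update (fun _ => 1) j (v j)) - u j| ≤ 3 * A ^ 2) {Chat : ℝ}
    (hChat : |Chat - mcdf ν v| ≤ 3 * d * A ^ 2) :
    |copulaRemainder μ ν Chat u| ≤
      (3 * d + (2 * √(24 * d) + 2) + d * (2 * √24 + 5) + d * (12 * (√(24 * d * K) + 1))) *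
        (A * √A) := by
  have hA0 := hA.1.le
  have huI : ∀ j, u j ∈ Icc (0 : ℝ) 1 := fun j => ⟨(hu j).1.le, (hu j).2.le⟩
  have hAA : A ^ 2 ≤ A * √A := by
    rw [sq]
    refine mul_le_mul_of_nonneg_left (Real.le_sqrt_of_sq_le ?_) hA0
    nlinarith [hA.2]
  have hδ := fun j => hcl.abs_quantile_sub_le hμ hA0 hν0 hν1 j (huI j) (hv j) (hvq j)
  have hδA : ∀ j, |v j - u j| ≤ 24 * A := fun j => by
    refine (hδ j).1.trans ?_
    have : √(u j * (1 - u j)) ≤ 1 := Real.sqrt_le_one.2 (by nlinarith [(hu j).1, (hu j).2])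
    nlinarith [hA.1, hA.2]
  have hsum : ∑ j, |v j - u j| ≤ 24 * d * A := by
    refine (Finset.sum_le_sum fun j _ => hδA j).trans (le_of_eq ?_)
    simp; ring
  have hsq : ∀ c : ℝ, 0 ≤ c → A * √(c * A) = √c * (A * √A) := fun c hc => by
    rw [Real.sqrt_mul hc]; ring
  have hosc : |(mcdf ν v - mcdf μ v) - (mcdf ν u - mcdf μ u)| ≤
      (2 * √(24 * d) + 2) * (A * √A) := by
    have h := hcl.abs_oscillation_le hA0 huI hv (ρ := 24 * d * A)
      ((measureReal_orthant_diff_le_sum hμ fun j => (hv j).2).trans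
        ((Finset.sum_le_sum fun j _ => max_le (abs_nonneg _) (le_abs_self _)).trans hsum))
      ((measureReal_orthant_diff_le_sum hμ fun j => (huI j).2).trans
        ((Finset.sum_le_sum fun j _ => max_le (abs_nonneg _)
          ((le_abs_self _).trans (abs_sub_comm _ _).le)).trans hsum))
    rw [hsq _ (by positivity)] at h
    linarith
  have hup : ∀ (w : Fin d → ℝ) j, w j ∈ Icc (0 : ℝ) 1 → ∀ k,
      Function.update (fun _ : Fin d => (1 : ℝ)) j (w j) k ∈ Icc (0 : ℝ) 1 := fun w j hw k => by
    rcases eq_or_ne k j with rfl | hk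
    · simpa using hw
    · simp [hk]
  have hdiff : ∀ (x y : Fin d → ℝ) j, y j ∈ Icc (0 : ℝ) 1 → |y j - x j| ≤ 24 * A →
      μ.real (Iic (Function.update (fun _ => 1) j (y j)) \
        Iic (Function.update (fun _ => 1) j (x j))) ≤ 24 * A := by
    intro x y j hy h
    refine (measureReal_orthant_diff_le_sum hμ fun k => (hup y j hy k).2).trans ?_
    rw [Finset.sum_eq_single j]
    · rw [Function.update_self, Function.update_self]
      exact max_le (by positivity) ((le_abs_self _).trans h)
    · intro k _ hk; simp [hk]
    · simp
  have he : ∀ j, |Cdot (mcdf μ) j u * coordError ν u v j| ≤ (2 * √24 + 5) * (A * √A) := by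
    intro j
    rw [abs_mul, abs_of_nonneg (Cdot_nonneg hC (mem_VV_of_Ioo hu j))]
    refine (mul_le_of_le_one_left (abs_nonneg _) (Cdot_le_one hμ hC (mem_VV_of_Ioo hu j))).trans ?_
    rw [coordError_eq hμ (huI j) (hv j)]
    have h := hcl.abs_oscillation_le hA0 (hup u j (huI j)) (hup v j (hv j)) (ρ := 24 * A)
      (hdiff _ _ j (hv j) (hδA j))
      (hdiff _ _ j (huI j) ((abs_sub_comm _ _).le.trans (hδA j)))
    rw [hsq _ (by positivity)] at h
    refine (abs_sub _ _).trans ?_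
    linarith [hvq j]
  have hT := abs_mcdf_sub_linear_le hμ hC hu hv (τ := fun _ => 12 * (A * √(24 * d * K * A) + A ^ 2))
    fun j w hw hwj => by
      have hwI : ∀ k, w k ∈ Icc (0 : ℝ) 1 := fun k => uIcc_subset_Icc (huI k) (hv k) (hw k)
      have hwV : w ∈ VV d j := ⟨hwI, hwj⟩
      have huV := mem_VV_of_Ioo hu j
      refine abs_Cdot_sub_mul_le hμ hC hA0 huV hwV (hw j) (hδ j).1 (hδ j).2 ?_
      have h := hL j u w huV hwV
      rw [le_div_iff₀ (lt_min (mul_one_sub_pos huV) (mul_one_sub_pos hwV))] at h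
      refine h.trans ?_
      have hs : ∑ k, |w k - u k| ≤ 24 * d * A :=
        (Finset.sum_le_sum fun k _ => abs_sub_left_of_mem_uIcc (hw k)).trans hsum
      calc _ ≤ K * (24 * d * A) := by gcongr
        _ = _ := by ring
  rw [hsq _ (by positivity)] at hT
  simp only [Finset.sum_const, Finset.card_univ, Fintype.card_fin, nsmul_eq_mul] at hT
  have hE : |∑ j, Cdot (mcdf μ) j u * coordError ν u v j| ≤ d * ((2 * √24 + 5) * (A * √A)) := by
    refine (Finset.abs_sum_le_sum_abs _ _).trans ((Finset.sum_le_sum fun j _ => he j).trans ?_)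
    simp
  have hD := abs_copulaRemainder_le μ ν Chat u v
  have h1 := abs_add_le ((mcdf ν v - mcdf μ v) - (mcdf ν u - mcdf μ u))
    (∑ j, Cdot (mcdf μ) j u * coordError ν u v j)
  have h2 : 3 * d * A ^ 2 ≤ 3 * d * (A * √A) := by gcongr
  have h3 : (d : ℝ) * (12 * (√(24 * d * K) * (A * √A) + A ^ 2)) ≤
      d * (12 * (√(24 * d * K) * (A * √A) + A * √A)) := by gcongr
  linarith

end Bounds

end Remainder

section Boundary

variable {μ ν : Measure (Fin d → ℝ)} [IsProbabilityMeasure μ] [IsProbabilityMeasure ν]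
  {A K g : ℝ} {u v : Fin d → ℝ}

lemma mul_sqrt_le_add {A g : ℝ} (hg : 0 ≤ g) : A * √g ≤ g + A ^ 2 := by
  nlinarith [sq_nonneg (A - √g), Real.sq_sqrt hg, sq_nonneg A]

/-- Constant in the remainder bound near the boundary. -/
def boundaryConst (d : ℕ) (K : ℝ) : ℝ :=
  3 * d + 12 + 4 * √(25 * d) + (26 * d + 14) * (√(25 * d * K) + 1)

lemma sqrt_const_le {A K g : ℝ} (hA : 0 ≤ A) (hK : 0 ≤ K) (hg : 0 ≤ g) :
    A * √(25 * d * K * (g + A ^ 2)) + A ^ 2 ≤ (√(25 * d * K) + 1) * (A * √g + A ^ 2) := by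
  have h := mul_sqrt_mul_le (c := 25 * d * K) hA (by positivity) hg
  have : 0 ≤ A * √g := by positivity
  linarith

/-- Remainder bound where one coordinate is close to zero. -/
lemma abs_copulaRemainder_le_of_apply_le (hμ : UniformMarginals μ) (hC : Condition21 (mcdf μ))
    (hL : CdotLip (mcdf μ) K) (hK : 0 ≤ K) (hcl : CloseOnOrthants μ ν A) (hA : 0 ≤ A)
    (hν0 : ν.real (Iic fun _ => -1) = 0) (hν1 : ν.real (Iic fun _ => 1) = 1)
    (hu : ∀ j, u j ∈ Ioo (0 : ℝ) 1) (hv : ∀ j, v j ∈ Icc (0 : ℝ) 1)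
    (hvq : ∀ j, |mcdf ν (Function.update (fun _ => 1) j (v j)) - u j| ≤ 3 * A ^ 2) {Chat : ℝ}
    (hChat : |Chat - mcdf ν v| ≤ 3 * d * A ^ 2) {i : Fin d} (hi : u i ≤ g) :
    |copulaRemainder μ ν Chat u| ≤ boundaryConst d K * (A * √g + A ^ 2) := by
  have hg0 : 0 ≤ g := (hu i).1.le.trans hi
  have hd : (1 : ℝ) ≤ d := by exact_mod_cast i.pos
  have huI : ∀ j, u j ∈ Icc (0 : ℝ) 1 := fun j => ⟨(hu j).1.le, (hu j).2.le⟩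
  have huV := mem_VV_of_Ioo hu
  have hδ := fun j => hcl.abs_quantile_sub_le hμ hA hν0 hν1 j (huI j) (hv j) (hvq j)
  have hui : u i * (1 - u i) ≤ g := by nlinarith [hu i |>.1, hu i |>.2]
  have hB0 : 0 ≤ A * √g := by positivity
  have hA2 : 0 ≤ A ^ 2 := sq_nonneg A
  have hS := sqrt_const_le (d := d) hA hK hg0
  have hs0 : 0 ≤ √(25 * d * K) := Real.sqrt_nonneg _
  have hsB : A * √g + A ^ 2 ≤ (√(25 * d * K) + 1) * (A * √g + A ^ 2) :=
    le_mul_of_one_le_left (by positivity) (by linarith)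
  have hδi : |v i - u i| ≤ 12 * (A * √g + A ^ 2) := (hδ i).1.trans (by gcongr)
  have hvi : v i ≤ 25 * (g + A ^ 2) := by
    linarith [(le_abs_self _).trans hδi, mul_sqrt_le_add (A := A) hg0]
  have hui' : u i ≤ 25 * (g + A ^ 2) := by linarith
  have hκ : ∀ x ≤ 25 * (g + A ^ 2), K * x ≤ 25 * d * K * (g + A ^ 2) := fun x hx => by
    have h1 : K * x ≤ K * (25 * (g + A ^ 2)) := by gcongr
    have h2 : K * (25 * (g + A ^ 2)) ≤ d * (K * (25 * (g + A ^ 2))) :=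
      le_mul_of_one_le_left (by positivity) hd
    linarith
  have hosc : |(mcdf ν v - mcdf μ v) - (mcdf ν u - mcdf μ u)| ≤ 12 * (A * √g + A ^ 2) := by
    have h := hcl.abs_oscillation_le hA huI hv (ρ := 25 * (g + A ^ 2))
      ((measureReal_mono sdiff_subset (measure_ne_top _ _)).trans
        ((mcdf_le_apply hμ (hv i)).trans hvi))
      ((measureReal_mono sdiff_subset (measure_ne_top _ _)).trans
        ((mcdf_le_apply hμ (huI i)).trans hui'))
    have h2 := mul_sqrt_mul_le (c := 25) hA (by norm_num) hg0
    rw [show (25 : ℝ) = 5 ^ 2 by norm_num, Real.sqrt_sq (by norm_num)] at h2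
    rw [show (25 : ℝ) = 5 ^ 2 by norm_num] at h
    linarith
  have hT := abs_mcdf_sub_linear_le hμ hC hu hv
    (τ := fun _ => 12 * ((√(25 * d * K) + 1) * (A * √g + A ^ 2)))
    fun j w hw hwj => by
      have hwI : ∀ k, w k ∈ Icc (0 : ℝ) 1 := fun k => uIcc_subset_Icc (huI k) (hv k) (hw k)
      have hwV : w ∈ VV d j := ⟨hwI, hwj⟩
      rcases eq_or_ne i j with rfl | hij
      · refine (mul_le_of_le_one_left (abs_nonneg _) ?_).trans (hδi.trans (by linarith))
        rw [abs_le]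
        constructor <;> linarith [Cdot_nonneg hC hwV, Cdot_nonneg hC (huV i),
          Cdot_le_one hμ hC hwV, Cdot_le_one hμ hC (huV i)]
      · refine (abs_Cdot_sub_mul_le hμ hC hA (huV j) hwV (hw j) (hδ j).1 (hδ j).2
          (κ := 25 * d * K * (g + A ^ 2)) ?_).trans (by linarith)
        have hm := le_min (mul_one_sub_pos (huV j)).le (mul_one_sub_pos hwV).le
        refine (mul_le_mul_of_nonneg_right (abs_sub_le_max_of_nonneg (Cdot_nonneg hC hwV)
          (Cdot_nonneg hC (huV j))) hm).trans ?_
        rw [max_mul_of_nonneg _ _ hm]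
        refine max_le ?_ ?_
        · refine (mul_le_mul_of_nonneg_left (min_le_right _ _) (Cdot_nonneg hC hwV)).trans
            ((Cdot_mul_le hμ hC hL hij hwV).trans (hκ _ ?_))
          exact (hw i).2.trans (max_le hui' hvi)
        · exact (mul_le_mul_of_nonneg_left (min_le_left _ _) (Cdot_nonneg hC (huV j))).trans
            ((Cdot_mul_le hμ hC hL hij (huV j)).trans (hκ _ hui'))
  have he : ∀ j, |Cdot (mcdf μ) j u * coordError ν u v j| ≤
      14 * ((√(25 * d * K) + 1) * (A * √g + A ^ 2)) := by
    intro j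
    have hej := abs_coordError_le hμ hcl hA hν0 hν1 (huI j) (hδ j).1
    rw [abs_mul, abs_of_nonneg (Cdot_nonneg hC (huV j))]
    rcases eq_or_ne i j with rfl | hij
    · refine (mul_le_of_le_one_left (abs_nonneg _) (Cdot_le_one hμ hC (huV i))).trans
        (hej.trans ?_)
      have : A * √(u i * (1 - u i)) ≤ A * √g := by gcongr
      linarith
    · refine (mul_le_of_le_sqrt hA (by norm_num) (Cdot_nonneg hC (huV j))
        (Cdot_le_one hμ hC (huV j)) (mul_one_sub_pos (huV j)).le hej
        ((Cdot_mul_le hμ hC hL hij (huV j)).trans (hκ _ hui'))).trans (by linarith)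
  simp only [Finset.sum_const, Finset.card_univ, Fintype.card_fin, nsmul_eq_mul] at hT
  have hE : |∑ j, Cdot (mcdf μ) j u * coordError ν u v j| ≤
      d * (14 * ((√(25 * d * K) + 1) * (A * √g + A ^ 2))) := by
    refine (Finset.abs_sum_le_sum_abs _ _).trans ((Finset.sum_le_sum fun j _ => he j).trans ?_)
    simp
  have hD := abs_copulaRemainder_le μ ν Chat u v
  have h1 := abs_add_le ((mcdf ν v - mcdf μ v) - (mcdf ν u - mcdf μ u))
    (∑ j, Cdot (mcdf μ) j u * coordError ν u v j)
  have h2 : 3 * d * A ^ 2 ≤ 3 * d * (A * √g + A ^ 2) := by gcongr; linarith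
  have h3 : 0 ≤ √(25 * (d : ℝ)) * (A * √g + A ^ 2) := by positivity
  have h4 : 0 ≤ (√(25 * d * K) + 1) * (A * √g + A ^ 2) := by positivity
  rw [boundaryConst]
  linarith

/-- Remainder bound where all but one coordinate are close to one. -/
lemma abs_copulaRemainder_le_of_one_sub_le (hμ : UniformMarginals μ) (hC : Condition21 (mcdf μ))
    (hL : CdotLip (mcdf μ) K) (hK : 0 ≤ K) (hcl : CloseOnOrthants μ ν A) (hA : 0 ≤ A)
    (hν0 : ν.real (Iic fun _ => -1) = 0) (hν1 : ν.real (Iic fun _ => 1) = 1)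
    (hu : ∀ j, u j ∈ Ioo (0 : ℝ) 1) (hv : ∀ j, v j ∈ Icc (0 : ℝ) 1)
    (hvq : ∀ j, |mcdf ν (Function.update (fun _ => 1) j (v j)) - u j| ≤ 3 * A ^ 2) {Chat : ℝ}
    (hChat : |Chat - mcdf ν v| ≤ 3 * d * A ^ 2) (hg0 : 0 ≤ g) {i : Fin d}
    (hi : ∀ k, k ≠ i → 1 - u k ≤ g) :
    |copulaRemainder μ ν Chat u| ≤ boundaryConst d K * (A * √g + A ^ 2) := by
  have huI : ∀ j, u j ∈ Icc (0 : ℝ) 1 := fun j => ⟨(hu j).1.le, (hu j).2.le⟩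
  have huV := mem_VV_of_Ioo hu
  have hδ := fun j => hcl.abs_quantile_sub_le hμ hA hν0 hν1 j (huI j) (hv j) (hvq j)
  have huk : ∀ k, k ≠ i → u k * (1 - u k) ≤ g := fun k hk => by
    nlinarith [hu k |>.1, hu k |>.2, hi k hk]
  have hB0 : 0 ≤ A * √g := by positivity
  have hA2 : 0 ≤ A ^ 2 := sq_nonneg A
  have hS := sqrt_const_le (d := d) hA hK hg0
  have hs0 : 0 ≤ √(25 * d * K) := Real.sqrt_nonneg _
  have hsB : A * √g + A ^ 2 ≤ (√(25 * d * K) + 1) * (A * √g + A ^ 2) :=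
    le_mul_of_one_le_left (by positivity) (by linarith)
  have hδk : ∀ k, k ≠ i → |v k - u k| ≤ 12 * (A * √g + A ^ 2) := fun k hk =>
    (hδ k).1.trans (by have := huk k hk; gcongr)
  have hr0 : 0 ≤ 25 * (g + A ^ 2) := by positivity
  have hvk : ∀ k, k ≠ i → 1 - v k ≤ 25 * (g + A ^ 2) := fun k hk => by
    linarith [(neg_abs_le _).trans' (neg_le_neg (hδk k hk)), mul_sqrt_le_add (A := A) hg0, hi k hk]
  have huk' : ∀ k, k ≠ i → 1 - u k ≤ 25 * (g + A ^ 2) := fun k hk => by linarith [hi k hk]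
  have hκ : K * (d * (25 * (g + A ^ 2))) = 25 * d * K * (g + A ^ 2) := by ring
  have hQ : ∀ w : Fin d → ℝ, (∀ k, w k ∈ Icc (0 : ℝ) 1) →
      (∀ k, k ≠ i → 1 - w k ≤ 25 * (g + A ^ 2)) →
      |(mcdf ν w - mcdf μ w) - (mcdf ν (Function.update (fun _ => 1) i (w i)) -
        mcdf μ (Function.update (fun _ => 1) i (w i)))| ≤
      2 * (√(25 * d) + 1) * (A * √g + A ^ 2) := by
    intro w hw hwk
    have hup : ∀ k, Function.update (fun _ : Fin d => (1 : ℝ)) i (w i) k ∈ Icc (0 : ℝ) 1 :=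
      fun k => by
        rcases eq_or_ne k i with rfl | hk
        · simpa using hw k
        · simp [hk]
    have h := hcl.abs_oscillation_le hA hup hw (ρ := 25 * d * (g + A ^ 2))
      ((measureReal_orthant_diff_le_sum hμ fun j => (hw j).2).trans ?_)
      ((measureReal_orthant_diff_le_sum hμ fun j => (hup j).2).trans ?_)
    · have h2 := mul_sqrt_mul_le (c := 25 * d) hA (by positivity) hg0
      linarith
    · refine (Finset.sum_nonpos fun k _ => ?_).trans (by positivity)
      refine max_le le_rfl ?_
      rcases eq_or_ne k i with rfl | hk
      · simp
      · simpa [hk] using (hw k).2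
    · refine (Finset.sum_le_sum (g := fun _ => 25 * (g + A ^ 2)) fun k _ => ?_).trans
        (le_of_eq (by simp; ring))
      refine max_le hr0 ?_
      rcases eq_or_ne k i with rfl | hk
      · simpa using hr0
      · simpa [hk] using hwk k hk
  have hT := abs_mcdf_sub_linear_le hμ hC hu hv
    (τ := fun _ => 12 * ((√(25 * d * K) + 1) * (A * √g + A ^ 2)))
    fun j w hw hwj => by
      have hwI : ∀ k, w k ∈ Icc (0 : ℝ) 1 := fun k => uIcc_subset_Icc (huI k) (hv k) (hw k)
      have hwV : w ∈ VV d j := ⟨hwI, hwj⟩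
      rcases eq_or_ne j i with rfl | hij
      · refine (abs_Cdot_sub_mul_le hμ hC hA (huV j) hwV (hw j) (hδ j).1 (hδ j).2
          (κ := 25 * d * K * (g + A ^ 2)) ?_).trans (by linarith)
        have hm := le_min (mul_one_sub_pos (huV j)).le (mul_one_sub_pos hwV).le
        have a1 : 0 ≤ 1 - Cdot (mcdf μ) j w := sub_nonneg.2 (Cdot_le_one hμ hC hwV)
        have a2 : 0 ≤ 1 - Cdot (mcdf μ) j u := sub_nonneg.2 (Cdot_le_one hμ hC (huV j))
        have h := abs_sub_le_max_of_nonneg a2 a1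
        rw [sub_sub_sub_cancel_left] at h
        refine (mul_le_mul_of_nonneg_right h hm).trans ?_
        rw [max_mul_of_nonneg _ _ hm, ← hκ]
        refine max_le ?_ ?_
        · exact (mul_le_mul_of_nonneg_left (min_le_left _ _) a2).trans
            (one_sub_Cdot_mul_le hμ hC hL hK (huV j) hr0 huk')
        · refine (mul_le_mul_of_nonneg_left (min_le_right _ _) a1).trans
            (one_sub_Cdot_mul_le hμ hC hL hK hwV hr0 fun k hk => ?_)
          have := (hw k).1
          rcases min_choice (u k) (v k) with h | h <;> rw [h] at this
          · linarith [huk' k hk]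
          · linarith [hvk k hk]
      · refine (mul_le_of_le_one_left (abs_nonneg _) ?_).trans ((hδk j hij).trans (by linarith))
        rw [abs_le]
        constructor <;> linarith [Cdot_nonneg hC hwV, Cdot_nonneg hC (huV j),
          Cdot_le_one hμ hC hwV, Cdot_le_one hμ hC (huV j)]
  have he : ∀ j ∈ Finset.univ.erase i, |Cdot (mcdf μ) j u * coordError ν u v j| ≤
      14 * (A * √g + A ^ 2) := by
    intro j hj
    have hji := Finset.ne_of_mem_erase hj
    have hej := abs_coordError_le hμ hcl hA hν0 hν1 (huI j) (hδ j).1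
    rw [abs_mul, abs_of_nonneg (Cdot_nonneg hC (huV j))]
    refine (mul_le_of_le_one_left (abs_nonneg _) (Cdot_le_one hμ hC (huV j))).trans
      (hej.trans ?_)
    have := huk j hji
    gcongr
  have hei : |(1 - Cdot (mcdf μ) i u) * coordError ν u v i| ≤
      14 * ((√(25 * d * K) + 1) * (A * √g + A ^ 2)) := by
    have a1 : 0 ≤ 1 - Cdot (mcdf μ) i u := sub_nonneg.2 (Cdot_le_one hμ hC (huV i))
    rw [abs_mul, abs_of_nonneg a1]
    refine (mul_le_of_le_sqrt hA (by norm_num) a1 (by linarith [Cdot_nonneg hC (huV i)])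
      (mul_one_sub_pos (huV i)).le (abs_coordError_le hμ hcl hA hν0 hν1 (huI i) (hδ i).1)
      ((one_sub_Cdot_mul_le hμ hC hL hK (huV i) hr0 huk').trans hκ.le)).trans (by linarith)
  simp only [Finset.sum_const, Finset.card_univ, Fintype.card_fin, nsmul_eq_mul] at hT
  have hE : |∑ j ∈ Finset.univ.erase i, Cdot (mcdf μ) j u * coordError ν u v j| ≤
      d * (14 * (A * √g + A ^ 2)) := by
    refine (Finset.abs_sum_le_sum_abs _ _).trans ((Finset.sum_le_sum he).trans ?_)
    rw [Finset.sum_const, nsmul_eq_mul]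
    gcongr
    simp
  have hD := abs_copulaRemainder_le μ ν Chat u v
  have hmain : |((mcdf ν v - mcdf μ v) - (mcdf ν u - mcdf μ u)) +
      ∑ j, Cdot (mcdf μ) j u * coordError ν u v j| ≤
      4 * (√(25 * d) + 1) * (A * √g + A ^ 2) + 3 * A ^ 2 +
        14 * ((√(25 * d * K) + 1) * (A * √g + A ^ 2)) + d * (14 * (A * √g + A ^ 2)) := by
    have q1 := abs_le.1 (hQ u huI huk')
    have q2 := abs_le.1 (hQ v hv hvk)
    have q3 := abs_le.1 (hvq i)
    have q4 := abs_le.1 hei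
    have q5 := abs_le.1 hE
    have q6 := coordError_eq (ν := ν) hμ (huI i) (hv i)
    rw [← Finset.add_sum_erase _ _ (Finset.mem_univ i), abs_le]
    constructor <;> linarith
  have h2 : 3 * d * A ^ 2 ≤ 3 * d * (A * √g + A ^ 2) := by gcongr; linarith
  have h5 : (d : ℝ) * (A * √g + A ^ 2) ≤ d * ((√(25 * d * K) + 1) * (A * √g + A ^ 2)) := by
    gcongr
  rw [boundaryConst]
  linarith

lemma exists_apply_eq_g1_or (hd : 2 ≤ d) (u : Fin d → ℝ) :
    (∃ i, u i = g1 u) ∨ ∃ i, ∀ k, k ≠ i → 1 - u k ≤ g1 u := by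
  have : Nonempty (Fin d) := ⟨⟨0, by lia⟩⟩
  rcases min_choice (⨅ j, u j) (⨅ j : Fin d, (1 - ⨅ k : {k : Fin d // k ≠ j}, u (k : Fin d)))
    with h | h
  · left
    obtain ⟨i, hi⟩ := exists_eq_ciInf_of_finite (f := u)
    exact ⟨i, by rw [g1, h, hi]⟩
  · right
    obtain ⟨i, hi⟩ := exists_eq_ciInf_of_finite
      (f := fun j : Fin d => 1 - ⨅ k : {k : Fin d // k ≠ j}, u (k : Fin d))
    refine ⟨i, fun k hk => ?_⟩
    rw [g1, h, ← hi]
    have := ciInf_le (Finite.bddBelow_range fun k : {k : Fin d // k ≠ i} => u (k : Fin d)) ⟨k, hk⟩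
    simp only at this ⊢
    linarith

lemma le_g1 (hd : 2 ≤ d) {u : Fin d → ℝ} {r : ℝ} (h : ∀ j, r ≤ u j ∧ u j ≤ 1 - r) : r ≤ g1 u := by
  have : Nonempty (Fin d) := ⟨⟨0, by lia⟩⟩
  refine le_min (le_ciInf fun j => (h j).1) (le_ciInf fun j => ?_)
  have : Nontrivial (Fin d) := Fin.nontrivial_iff_two_le.2 hd
  obtain ⟨k, hk⟩ := exists_ne j
  have := ciInf_le (Finite.bddBelow_range fun k : {k : Fin d // k ≠ j} => u (k : Fin d)) ⟨k, hk⟩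
  linarith [(h k).2]

/-- Remainder bound in terms of the weight function. -/
lemma abs_copulaRemainder_le_g1 (hd : 2 ≤ d) (hμ : UniformMarginals μ)
    (hC : Condition21 (mcdf μ))
    (hL : CdotLip (mcdf μ) K) (hK : 0 ≤ K) (hcl : CloseOnOrthants μ ν A) (hA : 0 ≤ A)
    (hν0 : ν.real (Iic fun _ => -1) = 0) (hν1 : ν.real (Iic fun _ => 1) = 1)
    (hu : ∀ j, u j ∈ Ioo (0 : ℝ) 1) (hv : ∀ j, v j ∈ Icc (0 : ℝ) 1)
    (hvq : ∀ j, |mcdf ν (Function.update (fun _ => 1) j (v j)) - u j| ≤ 3 * A ^ 2) {Chat : ℝ}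
    (hChat : |Chat - mcdf ν v| ≤ 3 * d * A ^ 2) (hg : 0 ≤ g1 u) :
    |copulaRemainder μ ν Chat u| ≤ boundaryConst d K * (A * √(g1 u) + A ^ 2) := by
  rcases exists_apply_eq_g1_or hd u with ⟨i, hi⟩ | ⟨i, hi⟩
  · exact abs_copulaRemainder_le_of_apply_le hμ hC hL hK hcl hA hν0 hν1 hu hv hvq hChat hi.le
  · exact abs_copulaRemainder_le_of_one_sub_le hμ hC hL hK hcl hA hν0 hν1 hu hv hvq hChat hg hi

end Boundary

/-- Proportion of the indices `1, …, n` satisfying `p`. -/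
def freq (n : ℕ) (p : ℤ → Prop) : ℝ :=
  (n : ℝ)⁻¹ * ∑ i ∈ Finset.Icc (1 : ℤ) (n : ℤ), indic {k | p k} i

section Freq

variable {n : ℕ} {p q r : ℤ → Prop}

lemma freq_le_add_sum {ι : Type*} (s : Finset ι) {q : ι → ℤ → Prop}
    (h : ∀ i ∈ Finset.Icc (1 : ℤ) (n : ℤ), p i → r i ∨ ∃ j ∈ s, q j i) :
    freq n p ≤ freq n r + ∑ j ∈ s, freq n (q j) := by
  simp only [freq]
  rw [← Finset.mul_sum, ← mul_add, Finset.sum_comm, ← Finset.sum_add_distrib]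
  refine mul_le_mul_of_nonneg_left (Finset.sum_le_sum fun i hi => ?_) (by positivity)
  have h0 : ∀ j, 0 ≤ indic {k | q j k} i := fun j => by
    rcases indic_mem {k | q j k} i with h | h <;> simp [h.1]
  have h1 := Finset.sum_nonneg fun j (_ : j ∈ s) => h0 j
  rcases indic_mem {k | r k} i with hr | hr
  · rw [hr.1]
    rcases indic_mem {k | p k} i with hp | hp <;> rw [hp.1] <;> linarith
  · rcases indic_mem {k | p k} i with hp | hp
    · obtain ⟨j, hj, hq⟩ := (h i hi hp.2).resolve_left hr.2
      have h2 := Finset.single_le_sum (fun j (_ : j ∈ s) => h0 j) hj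
      rcases indic_mem {k | q j k} i with hq' | hq'
      · rw [hq'.1] at h2
        rw [hp.1, hr.1]
        linarith
      · exact absurd hq hq'.2
    · rw [hp.1, hr.1]
      linarith

lemma freq_mono (h : ∀ i ∈ Finset.Icc (1 : ℤ) (n : ℤ), p i → q i) : freq n p ≤ freq n q := by
  simpa using freq_le_add_sum (ι := ℕ) ∅ (q := fun _ => p) fun i hi hp => Or.inl (h i hi hp)

lemma freq_le_add (h : ∀ i ∈ Finset.Icc (1 : ℤ) (n : ℤ), p i → q i ∨ r i) :
    freq n p ≤ freq n q + freq n r := by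
  simpa using freq_le_add_sum {()} (q := fun _ => r) fun i hi hp => by simpa using h i hi hp

lemma freq_add_inv_le {i : ℤ} (hi : i ∈ Finset.Icc (1 : ℤ) (n : ℤ)) (hpi : ¬ p i) (hqi : q i)
    (h : ∀ k ∈ Finset.Icc (1 : ℤ) (n : ℤ), p k → q k) : freq n p + (n : ℝ)⁻¹ ≤ freq n q := by
  simp only [freq]
  rw [← mul_add_one]
  refine mul_le_mul_of_nonneg_left ?_ (by positivity)
  rw [← Finset.add_sum_erase _ _ hi, ← Finset.add_sum_erase _ (fun k => indic {k | q k} k) hi]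
  have h2 : ∑ k ∈ (Finset.Icc (1 : ℤ) (n : ℤ)).erase i, indic {k | p k} k ≤
      ∑ k ∈ (Finset.Icc (1 : ℤ) (n : ℤ)).erase i, indic {k | q k} k := by
    refine Finset.sum_le_sum fun k hk => ?_
    rcases indic_mem {k | p k} k with hp | hp <;> rcases indic_mem {k | q k} k with hq | hq
    · rw [hp.1, hq.1]
    · exact absurd (h k (Finset.mem_of_mem_erase hk) hp.2) hq.2
    · rw [hp.1, hq.1]; norm_num
    · rw [hp.1, hq.1]
  have hp := (indic_mem {k | p k} i).resolve_left fun h => hpi h.2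
  have hq := (indic_mem {k | q k} i).resolve_right fun h => h.2 hqi
  rw [hp.1, hq.1]
  linarith

lemma freq_eq_one (hn : 1 ≤ n) (h : ∀ i ∈ Finset.Icc (1 : ℤ) (n : ℤ), p i) : freq n p = 1 := by
  have hn' : (n : ℝ) ≠ 0 := by positivity
  rw [freq, Finset.sum_congr rfl fun i hi =>
    ((indic_mem {k | p k} i).resolve_right fun h' => h'.2 (h i hi)).1]
  simp [hn']

/-- The empirical quantile associated with pseudo-observations. -/
lemma exists_quantile {x U : ℤ → ℝ} (hn : 1 ≤ n) (hmono : ∀ i k, x i ≤ x k → U i ≤ U k)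
    (hU : ∀ i, U i ∈ Icc (0 : ℝ) 1) {m : ℝ}
    (hm : ∀ s ∈ Icc (0 : ℝ) 1, freq n (fun k => U k = s) ≤ m) {u : ℝ} (hu : u ∈ Icc (0 : ℝ) 1) :
    ∃ v ∈ Icc (0 : ℝ) 1,
      (∀ i ∈ Finset.Icc (1 : ℤ) (n : ℤ),
        (n : ℝ) / (n + 1) * freq n (fun k => x k ≤ x i) ≤ u → U i ≤ v) ∧
      (∀ i ∈ Finset.Icc (1 : ℤ) (n : ℤ), U i < v →
        (n : ℝ) / (n + 1) * freq n (fun k => x k ≤ x i) ≤ u) ∧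
      |freq n (fun k => U k ≤ v) - u| ≤ m := by
  have hn0 : (0 : ℝ) < n := by positivity
  set R : ℤ → ℝ := fun i => (n : ℝ) / (n + 1) * freq n (fun k => x k ≤ x i) with hR
  have hRmono : ∀ i k, x i ≤ x k → R i ≤ R k := fun i k h =>
    mul_le_mul_of_nonneg_left (freq_mono fun l _ hl => hl.trans h) (by positivity)
  set S := (Finset.Icc (1 : ℤ) (n : ℤ)).filter fun i => R i ≤ u with hS
  have hv : ∃ v ∈ Icc (0 : ℝ) 1, (∀ i ∈ Finset.Icc (1 : ℤ) (n : ℤ), R i ≤ u → U i ≤ v) ∧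
      (v = 0 ∨ ∃ i ∈ Finset.Icc (1 : ℤ) (n : ℤ), R i ≤ u ∧ U i = v) := by
    rcases S.eq_empty_or_nonempty with h | h
    · refine ⟨0, by simp, fun i hi hiu => ?_, Or.inl rfl⟩
      have : i ∈ S := Finset.mem_filter.2 ⟨hi, hiu⟩
      simp [h] at this
    · obtain ⟨i, hi, hmax⟩ := S.exists_max_image U h
      have hi' := Finset.mem_filter.1 hi
      exact ⟨U i, hU i, fun k hk hku => hmax k (Finset.mem_filter.2 ⟨hk, hku⟩),
        Or.inr ⟨i, hi'.1, hi'.2, rfl⟩⟩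
  obtain ⟨v, hv, hle, hex⟩ := hv
  have hlt : ∀ i ∈ Finset.Icc (1 : ℤ) (n : ℤ), U i < v → R i ≤ u := by
    intro i _ hiv
    rcases hex with rfl | ⟨k, _, hku, rfl⟩
    · exact absurd (hU i).1 (not_le.2 hiv)
    · refine (hRmono i k ?_).trans hku
      by_contra! h
      exact absurd (hmono _ _ h.le) (not_le.2 hiv)
  refine ⟨v, hv, hle, hlt, abs_le.2 ⟨?_, ?_⟩⟩
  · set T := (Finset.Icc (1 : ℤ) (n : ℤ)).filter fun i => u < R i with hT
    rcases T.eq_empty_or_nonempty with h | h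
    · have h1 : freq n (fun k => U k ≤ v) = 1 := freq_eq_one hn fun i hi => hle i hi <| by
        by_contra! hlt'
        have : i ∈ T := Finset.mem_filter.2 ⟨hi, hlt'⟩
        simp [h] at this
      have hm0 : 0 ≤ m := le_trans (by
        refine mul_nonneg (by positivity) (Finset.sum_nonneg fun i _ => ?_)
        rcases indic_mem {k | U k = 0} i with h | h <;> simp [h.1]) (hm 0 (by simp))
      rw [h1]
      linarith [hu.2]
    · obtain ⟨i, hi, hmin⟩ := T.exists_min_image x h
      have hi' := Finset.mem_filter.1 hi
      have h1 : freq n (fun k => x k ≤ x i) ≤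
          freq n (fun k => U k ≤ v) + freq n (fun k => U k = U i) := by
        refine freq_le_add fun k hk hki => ?_
        rcases hki.eq_or_lt with h | h
        · exact Or.inr (le_antisymm (hmono _ _ h.le) (hmono _ _ h.ge))
        · refine Or.inl (hle k hk ?_)
          by_contra! hlt'
          exact absurd (hmin k (Finset.mem_filter.2 ⟨hk, hlt'⟩)) (not_le.2 h)
      have h2 : u < n / (n + 1) * freq n (fun k => x k ≤ x i) := hi'.2
      have h3 : 0 ≤ freq n (fun k => x k ≤ x i) := by
        by_contra! h
        exact absurd (h2.trans (mul_neg_of_pos_of_neg (by positivity) h)) (not_lt.2 hu.1)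
      have h4 : (n : ℝ) / (n + 1) ≤ 1 := (div_le_one (by positivity)).2 (by linarith)
      linarith [hm _ (hU i), mul_le_of_le_one_left h3 h4]
  · rcases hex with rfl | ⟨i, hi, hiu, rfl⟩
    · have := (freq_mono (n := n) (p := fun k => U k ≤ 0) fun k _ hk =>
        le_antisymm hk (hU k).1).trans (hm 0 (by simp))
      linarith [hu.1]
    · have h1 : freq n (fun k => U k ≤ U i) ≤ freq n (fun k => U k < U i) +
          freq n (fun k => U k = U i) := freq_le_add fun k _ hk => hk.lt_or_eq
      have h2 : freq n (fun k => U k < U i) + (n : ℝ)⁻¹ ≤ freq n (fun k => x k ≤ x i) :=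
        freq_add_inv_le hi (lt_irrefl _) le_rfl fun k _ hk => by
          by_contra! h
          exact absurd (hmono _ _ h.le) (not_le.2 hk)
      have h3 : freq n (fun k => x k ≤ x i) ≤ u * ((n + 1) / n) := by
        rw [← div_le_iff₀ (by positivity)]
        refine le_trans (le_of_eq ?_) hiu
        rw [div_div_eq_mul_div]
        ring
      have h4 : u * (((n : ℝ) + 1) / n) = u + u * (n : ℝ)⁻¹ := by field_simp
      have h5 : u * (n : ℝ)⁻¹ ≤ (n : ℝ)⁻¹ := mul_le_of_le_one_left (by positivity) hu.2
      linarith [hm _ (hU i)]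

end Freq

section EmpiricalCopula

variable {P : Measure Ω} [IsProbabilityMeasure P] {X : ℤ → Ω → Fin d → ℝ} {n : ℕ} {ω : Ω}

lemma empLawU_real_eq_freq (P : Measure Ω) (X : ℤ → Ω → Fin d → ℝ) (n : ℕ) (ω : Ω)
    {B : Set (Fin d → ℝ)} (hB : MeasurableSet B) :
    (empLawU P X n ω).real B = freq n fun i => Uv P X i ω ∈ B := by
  rw [empLawU_real_apply _ _ _ _ hB]
  rfl

lemma empLawU_Iic_neg_one (hd : 1 ≤ d) :
    (empLawU P X n ω).real (Iic fun _ => -1) = 0 := by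
  rw [empLawU_real_apply _ _ _ _ measurableSet_Iic, Finset.sum_eq_zero, mul_zero]
  intro i _
  refine ((indic_mem _ _).resolve_left fun h => ?_).1
  have h1 : Uv P X i ω ⟨0, hd⟩ ≤ -1 := h.2 ⟨0, hd⟩
  linarith [(Uv_mem_Icc P X i ω ⟨0, hd⟩).1]

lemma empLawU_Iic_one (hn : 1 ≤ n) : (empLawU P X n ω).real (Iic fun _ => 1) = 1 := by
  rw [empLawU_real_eq_freq _ _ _ _ measurableSet_Iic]
  exact freq_eq_one hn fun i _ j => (Uv_mem_Icc P X i ω j).2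

/-- The empirical copula is close to the empirical law of the `U_i` at the empirical quantiles. -/
lemma exists_empCop_approx (hn : 1 ≤ n) {m : ℝ}
    (hm : ∀ j, ∀ s ∈ Icc (0 : ℝ) 1, (empLawU P X n ω).real {x | x j = s} ≤ m)
    {u : Fin d → ℝ} (hu : ∀ j, u j ∈ Icc (0 : ℝ) 1) :
    ∃ v : Fin d → ℝ, (∀ j, v j ∈ Icc (0 : ℝ) 1) ∧
      (∀ j, |mcdf (empLawU P X n ω) (Function.update (fun _ => 1) j (v j)) - u j| ≤ m) ∧
      |empCop X n u ω - mcdf (empLawU P X n ω) v| ≤ d * m := by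
  have hmeas : ∀ (j : Fin d) (s : ℝ), MeasurableSet {x : Fin d → ℝ | x j = s} := fun j s =>
    measurableSet_eq_fun (measurable_pi_apply j) measurable_const
  have hm' : ∀ j, ∀ s ∈ Icc (0 : ℝ) 1, freq n (fun k => Uv P X k ω j = s) ≤ m := fun j s hs => by
    have h := hm j s hs
    rwa [empLawU_real_eq_freq _ _ _ _ (hmeas j s)] at h
  have hq := fun j => exists_quantile (x := fun i => X i ω j) (U := fun i => Uv P X i ω j) hn
    (fun i k h => monotone_margF P X j h) (fun i => Uv_mem_Icc P X i ω j) (hm' j) (hu j)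
  choose v hv hle hlt hvu using hq
  have hps : ∀ i j, pseudoObs X n i ω j =
      (n : ℝ) / (n + 1) * freq n (fun k => X k ω j ≤ X i ω j) := fun i j => rfl
  refine ⟨v, hv, fun j => ?_, ?_⟩
  · rw [mcdf, empLawU_real_eq_freq _ _ _ _ measurableSet_Iic]
    have : (fun i => Uv P X i ω ∈ Iic (Function.update (fun _ => 1) j (v j))) =
        fun i => Uv P X i ω j ≤ v j := by
      ext i
      refine ⟨fun h => by simpa using h j, fun h k => ?_⟩
      rcases eq_or_ne k j with rfl | hk
      · simpa using h
      · simpa [hk] using (Uv_mem_Icc P X i ω k).2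
    rw [this]
    exact hvu j
  · rw [mcdf, empLawU_real_eq_freq _ _ _ _ measurableSet_Iic]
    have h0 : empCop X n u ω = freq n fun i => ∀ j, pseudoObs X n i ω j ≤ u j := rfl
    have h1 : empCop X n u ω ≤ freq n fun i => Uv P X i ω ∈ Iic v :=
      freq_mono fun i hi h j => hle j i hi (h j)
    have h2 : (freq n fun i => Uv P X i ω ∈ Iic v) ≤ empCop X n u ω +
        ∑ j, freq n fun i => Uv P X i ω j = v j := by
      rw [h0]
      refine freq_le_add_sum _ fun i hi h => or_iff_not_imp_left.2 fun hnot => ?_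
      obtain ⟨j, hj⟩ := not_forall.1 hnot
      refine ⟨j, Finset.mem_univ j, le_antisymm (h j) (not_lt.1 fun hlt' => hj ?_)⟩
      exact hlt j i hi hlt'
    have h3 : ∑ j, (freq n fun i => Uv P X i ω j = v j) ≤ d * m := by
      refine (Finset.sum_le_sum fun j _ => hm' j _ (hv j)).trans ?_
      simp
    have h4 := (sub_nonneg.2 h1).trans (sub_le_iff_le_add'.2 h2)
    rw [abs_le]
    constructor <;> linarith

end EmpiricalCopula

/-- Combination of the bulk and the boundary bounds for the weighted remainder. -/
lemma sqrt_mul_div_rpow_le {n : ℕ} (hn : 1 ≤ n) {η a c g D M₁ M₂ : ℝ} (hη : 0 < η)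
    (hη' : 16 * η ≤ 1 / 2) (ha : 0 ≤ a) (hc : 0 < c) (hM₁ : 0 ≤ M₁) (hM₂ : 0 ≤ M₂)
    (hg : c / n ≤ g)
    (h₁ : D ≤ M₁ * (a * (n : ℝ) ^ (η - 1 / 2) * √(a * (n : ℝ) ^ (η - 1 / 2))))
    (h₂ : D ≤ M₂ * (a * (n : ℝ) ^ (η - 1 / 2) * √g + (a * (n : ℝ) ^ (η - 1 / 2)) ^ 2)) :
    √n * D / g ^ (1 / 2 - 16 * η) ≤
      (M₁ * (a * √a) + M₂ * (a + a ^ 2 / √c)) * (n : ℝ) ^ (-(2 * η)) := by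
  have hn1 : (1 : ℝ) ≤ n := by exact_mod_cast hn
  have hn0 : (0 : ℝ) < n := by positivity
  have hg0 : 0 < g := (by positivity : 0 < c / n).trans_le hg
  have hw : 0 < g ^ (1 / 2 - 16 * η) := Real.rpow_pos_of_pos hg0 _
  have hsn : (√n : ℝ) = (n : ℝ) ^ (1 / 2 : ℝ) := Real.sqrt_eq_rpow _
  have hnn : 0 ≤ (n : ℝ) ^ (-(2 * η)) := by positivity
  have hc' : 0 < √c := Real.sqrt_pos.2 hc
  rw [div_le_iff₀ hw]
  rcases le_total ((n : ℝ) ^ (-(1 / 4) : ℝ)) g with hgn | hgn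
  · have e1 : √n * (M₁ * (a * (n : ℝ) ^ (η - 1 / 2) * √(a * (n : ℝ) ^ (η - 1 / 2)))) =
        M₁ * (a * √a) * (n : ℝ) ^ (-(1 / 4) + 3 / 2 * η) := by
      have : (n : ℝ) ^ (-(1 / 4) + 3 / 2 * η) = (n : ℝ) ^ (1 / 2 : ℝ) *
          (n : ℝ) ^ (η - 1 / 2) * (n : ℝ) ^ ((η - 1 / 2) * (1 / 2)) := by
        rw [← Real.rpow_add hn0, ← Real.rpow_add hn0]
        congr 1; ring
      rw [Real.sqrt_mul ha, Real.sqrt_eq_rpow ((n : ℝ) ^ (η - 1 / 2)), ← Real.rpow_mul hn0.le,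
        this, hsn]
      ring
    have e2 : (n : ℝ) ^ (-(1 / 4) + 3 / 2 * η) ≤
        (n : ℝ) ^ (-(2 * η)) * g ^ (1 / 2 - 16 * η) := by
      calc (n : ℝ) ^ (-(1 / 4) + 3 / 2 * η)
          ≤ (n : ℝ) ^ (-(2 * η) + -(1 / 4) * (1 / 2 - 16 * η)) :=
            Real.rpow_le_rpow_of_exponent_le hn1 (by linarith)
        _ = (n : ℝ) ^ (-(2 * η)) * ((n : ℝ) ^ (-(1 / 4) : ℝ)) ^ (1 / 2 - 16 * η) := by
            rw [Real.rpow_add hn0, Real.rpow_mul hn0.le]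
        _ ≤ _ := by gcongr
    calc √n * D ≤ M₁ * (a * √a) * (n : ℝ) ^ (-(1 / 4) + 3 / 2 * η) := by
          rw [← e1]; gcongr
      _ ≤ M₁ * (a * √a) * ((n : ℝ) ^ (-(2 * η)) * g ^ (1 / 2 - 16 * η)) := by gcongr
      _ = (M₁ * (a * √a) + 0) * (n : ℝ) ^ (-(2 * η)) * g ^ (1 / 2 - 16 * η) := by ring
      _ ≤ _ := by gcongr; positivity
  · set N := (n : ℝ) ^ η with hN
    have hN1 : 1 ≤ N := Real.one_le_rpow hn1 hη.le
    have hSpos : 0 < √(n : ℝ) := Real.sqrt_pos.2 hn0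
    have hA : (n : ℝ) ^ (η - 1 / 2) = N / √n := by rw [Real.rpow_sub hn0, hsn]
    have hinv : (√(n : ℝ))⁻¹ ≤ √g / √c := by
      rw [← Real.sqrt_inv, ← Real.sqrt_div' _ hc.le]
      refine Real.sqrt_le_sqrt ?_
      rw [le_div_iff₀ hc]
      rwa [div_eq_inv_mul] at hg
    have hNsq : N ^ 2 = (n : ℝ) ^ (2 * η) := by
      rw [hN, ← Real.rpow_natCast, ← Real.rpow_mul hn0.le]
      congr 1; push_cast; ring
    have e1 : √n * (M₂ * (a * (n : ℝ) ^ (η - 1 / 2) * √g + (a * (n : ℝ) ^ (η - 1 / 2)) ^ 2)) =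
        M₂ * (a * N * √g + a ^ 2 * N ^ 2 * (√(n : ℝ))⁻¹) := by
      rw [hA]
      field_simp
    have e2 : √g ≤ (n : ℝ) ^ (-(4 * η)) * g ^ (1 / 2 - 16 * η) := by
      calc √g = g ^ (16 * η) * g ^ (1 / 2 - 16 * η) := by
            rw [← Real.rpow_add hg0, Real.sqrt_eq_rpow]; congr 1; ring
        _ ≤ ((n : ℝ) ^ (-(1 / 4) : ℝ)) ^ (16 * η) * g ^ (1 / 2 - 16 * η) := by gcongr
        _ = _ := by rw [← Real.rpow_mul hn0.le]; congr 2; ring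
    have e3 : N ^ 2 * √g ≤ (n : ℝ) ^ (-(2 * η)) * g ^ (1 / 2 - 16 * η) := by
      calc N ^ 2 * √g ≤ (n : ℝ) ^ (2 * η) * ((n : ℝ) ^ (-(4 * η)) * g ^ (1 / 2 - 16 * η)) := by
            rw [hNsq]; gcongr
        _ = _ := by rw [← mul_assoc, ← Real.rpow_add hn0]; congr 2; ring
    have hNN : N ≤ N ^ 2 := by nlinarith
    calc √n * D ≤ M₂ * (a * N * √g + a ^ 2 * N ^ 2 * (√(n : ℝ))⁻¹) := by
          rw [← e1]; gcongr
      _ ≤ M₂ * (a * N ^ 2 * √g + a ^ 2 * N ^ 2 * (√g / √c)) := by gcongr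
      _ = M₂ * (a + a ^ 2 / √c) * (N ^ 2 * √g) := by field_simp
      _ ≤ M₂ * (a + a ^ 2 / √c) * ((n : ℝ) ^ (-(2 * η)) * g ^ (1 / 2 - 16 * η)) := by gcongr
      _ = (0 + M₂ * (a + a ^ 2 / √c)) * (n : ℝ) ^ (-(2 * η)) * g ^ (1 / 2 - 16 * η) := by ring
      _ ≤ _ := by gcongr; positivity

section Final

variable {P : Measure Ω} [IsProbabilityMeasure P] {X : ℤ → Ω → Fin d → ℝ}

lemma hatCP_sub_Cbar (hmeas : ∀ i, Measurable (X i)) (hcont : ∀ j, Continuous (margF P X j))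
    (n : ℕ) {u : Fin d → ℝ} (hu : ∀ j, u j ∈ Icc (0 : ℝ) 1) (ω : Ω) :
    hatCP P X n u ω - Cbar P X n u ω =
      √n * copulaRemainder (lawU P X) (empLawU P X n ω) (empCop X n u ω) u := by
  have := isProbabilityMeasure_lawU (P := P) hmeas hcont
  have hμ := uniformMarginals_lawU (P := P) hmeas hcont
  have hcop : cop P X = mcdf (lawU P X) := funext fun u => cop_eq_lawU hmeas hcont u
  simp only [hatCP, Cbar, alphan, Gn_eq_empLawU, hcop, mcdf_update_one hμ _ (hu _),
    copulaRemainder]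
  have : ∑ j, Cdot (mcdf (lawU P X)) j u * (√n *
      ((empLawU P X n ω).real (Iic (Function.update (fun _ => 1) j (u j))) - u j)) =
      √n * ∑ j, Cdot (mcdf (lawU P X)) j u *
        (mcdf (empLawU P X n ω) (Function.update (fun _ => 1) j (u j)) - u j) := by
    rw [Finset.mul_sum]
    exact Finset.sum_congr rfl fun j _ => by rw [mcdf]; ring
  rw [this]
  simp only [mcdf]
  ring

/-- On the event that the empirical law is close to the true one, the weighted remainder is
uniformly small. -/
lemma exists_weighted_remainder_le (hd : 2 ≤ d) (hmeas : ∀ i, Measurable (X i))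
    (hcont : ∀ j, Continuous (margF P X j)) (hC : Condition21 (cop P X)) {c η : ℝ} (hc : 0 < c)
    (hη : 0 < η) (hη' : 16 * η ≤ 1 / 2) :
    ∃ M, 0 ≤ M ∧ ∀ n : ℕ, 1 ≤ n → (1 + 2 * d) * (n : ℝ) ^ (η - 1 / 2) ≤ 1 → ∀ ω,
      CloseOnOrthants (lawU P X) (empLawU P X n ω) ((1 + 2 * d) * (n : ℝ) ^ (η - 1 / 2)) →
      ∀ u : Fin d → ℝ, (∀ j, c / n ≤ u j ∧ u j ≤ 1 - c / n) →
        |hatCP P X n u ω / gW (1 / 2 - 16 * η) u - Cbar P X n u ω / gW (1 / 2 - 16 * η) u| ≤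
          M * (n : ℝ) ^ (-(2 * η)) := by
  have hpr := isProbabilityMeasure_lawU (P := P) hmeas hcont
  have hμ := uniformMarginals_lawU (P := P) hmeas hcont
  have hcop : cop P X = mcdf (lawU P X) := funext fun u => cop_eq_lawU hmeas hcont u
  rw [hcop] at hC
  obtain ⟨K, hK, hL⟩ := exists_abs_Cdot_sub_le hC
  refine ⟨(3 * d + (2 * √(24 * d) + 2) + d * (2 * √24 + 5) + d * (12 * (√(24 * d * K) + 1))) *
    ((1 + 2 * d) * √(1 + 2 * d)) + boundaryConst d K * ((1 + 2 * d) + (1 + 2 * d) ^ 2 / √c),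
    by rw [boundaryConst]; positivity, fun n hn hA ω hcl u hu => ?_⟩
  have hn0 : (0 : ℝ) < n := by positivity
  have hcn : 0 < c / n := by positivity
  have huo : ∀ j, u j ∈ Ioo (0 : ℝ) 1 := fun j =>
    ⟨hcn.trans_le (hu j).1, by linarith [(hu j).2]⟩
  have huI : ∀ j, u j ∈ Icc (0 : ℝ) 1 := fun j => ⟨(huo j).1.le, (huo j).2.le⟩
  have hprn := isProbabilityMeasure_empLawU P X hn ω
  have hν0 := empLawU_Iic_neg_one (P := P) (X := X) (n := n) (ω := ω) (by lia : 1 ≤ d)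
  have hν1 := empLawU_Iic_one (P := P) (X := X) (ω := ω) hn
  have hA0 : 0 < (1 + 2 * d) * (n : ℝ) ^ (η - 1 / 2) := by positivity
  obtain ⟨v, hv, hvq, hChat⟩ := exists_empCop_approx hn
    (fun j s hs => hcl.measureReal_hyperplane_le hμ ⟨hA0, hA⟩ hν1 j hs) huI
  rw [← mul_assoc, mul_comm (d : ℝ) 3] at hChat
  have hg : c / n ≤ g1 u := le_g1 hd hu
  have hg0 : 0 < g1 u := hcn.trans_le hg
  rw [← sub_div, hatCP_sub_Cbar hmeas hcont n huI, abs_div, abs_mul,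
    abs_of_nonneg (Real.sqrt_nonneg _), gW, abs_of_pos (Real.rpow_pos_of_pos hg0 _)]
  refine sqrt_mul_div_rpow_le hn hη hη' (by positivity) hc (by positivity)
    (by rw [boundaryConst]; positivity) hg ?_ ?_
  · exact abs_copulaRemainder_le_bulk hμ hC hL hK.le hcl ⟨hA0, hA⟩ hν0 hν1 huo hv hvq hChat
  · exact abs_copulaRemainder_le_g1 hd hμ hC hL hK.le hcl hA0.le hν0 hν1 huo hv hvq hChat hg0.le

end Final

/-- Theorem 2.2 (weighted weak convergence of the empirical copula process,
approximation part), for exponentially alpha-mixing strictly stationary sequences. -/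
theorem weighted_approximation_empirical_copula_mixing
    {Ω : Type*} [MeasurableSpace Ω] {d : ℕ} (hd : 2 ≤ d)
    (P : Measure Ω) [IsProbabilityMeasure P] (X : ℤ → Ω → Fin d → ℝ)
    (hmeas : ∀ i, Measurable (X i)) (hstat : StrictlyStationary P X)
    (hcont : ∀ j, Continuous (margF P X j))
    (hmix : ExpAlphaMixing P X) (hC : Condition21 (cop P X)) :
    ∀ c ∈ Set.Ioo (0 : ℝ) 1, ∀ w ∈ Set.Ioo (0 : ℝ) (1/2),
      oP1 P (fun n ω =>
        ⨆ u ∈ {u : Fin d → ℝ | ∀ j, c / n ≤ u j ∧ u j ≤ 1 - c / n},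
          |hatCP P X n u ω / gW w u - Cbar P X n u ω / gW w u|) := by
  intro c hc w hw ε hε
  obtain ⟨η, rfl⟩ : ∃ η, w = 1 / 2 - 16 * η := ⟨(1 / 2 - w) / 16, by ring⟩
  have hη : 0 < η := by linarith [hw.2]
  have hη' : 16 * η ≤ 1 / 2 := by linarith [hw.1]
  obtain ⟨M, -, hM⟩ := exists_weighted_remainder_le hd hmeas hcont hC hc.1 hη hη'
  have hlim : ∀ (B y : ℝ), 0 < y → Tendsto (fun n : ℕ => B * (n : ℝ) ^ (-y)) atTop (nhds 0) :=
    fun B y hy => by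
      simpa using ((tendsto_rpow_neg_atTop hy).comp tendsto_natCast_atTop_atTop).const_mul B
  have e1 := (hlim M (2 * η) (by linarith)).eventually_le_const hε
  have e2 := (hlim (1 + 2 * d) (1 / 2 - η) (by linarith)).eventually_le_const one_pos
  refine tendsto_of_tendsto_of_tendsto_of_le_of_le' tendsto_const_nhds
    (tendsto_not_closeOnOrthants (by lia : 1 ≤ d) hmeas hstat hcont hmix hη)
    (Eventually.of_forall fun n => zero_le) ?_
  filter_upwards [e1, e2, eventually_ge_atTop 1] with n h1 h2 hn
  refine measure_mono fun ω (hω : ε * 1 < _) hcl => hω.not_ge ?_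
  rw [neg_sub] at h2
  rw [mul_one, abs_of_nonneg (Real.iSup_nonneg fun _ => Real.iSup_nonneg fun _ => abs_nonneg _)]
  exact Real.iSup_le (fun u => Real.iSup_le (fun hu => (hM n hn h2 ω hcl u hu).trans h1) hε.le)
    hε.le

end BBV
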